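/- arXiv:2604.05459 — 15 statements merged into one kernel-verified Lean document; each statement's English description precedes it below -/
import Mathlib

section
/- Let k ≥ 3 be an integer and let S be a set of integers containing no arithmetic progression of k distinct terms (i.e. no k-term arithmetic progression with nonzero common difference). Let d = d₁ + d₂ with d₁, d₂ ≥ 0, and suppose the Hilbert cube H(a₀; a₁, …, a_d) is contained in S, where all a₁, …, a_d are nonzero integers. If C is a real number such that every Hilbert cube of dimension d₁ with nonzero elements contained in S has cardinality at least C, then the cardinality of H(a₀; a₁, …, a_d) (as a set of integers) is at least ⌈C · (k/(k−1))^{d₂}⌉. -/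
/-- The Hilbert cube `H(a₀; a₁, …, a_d)` as a set of integers. -/
def hilbertCube (a₀ : ℤ) (d : ℕ) (a : Fin d → ℤ) : Set ℤ :=
  {x | ∃ ε : Fin d → Bool, x = a₀ + ∑ i, if ε i then a i else 0}

theorem hilbertCube_eq_range (a₀ : ℤ) (d : ℕ) (a : Fin d → ℤ) :
    hilbertCube a₀ d a = Set.range fun ε : Fin d → Bool => a₀ + ∑ i, if ε i then a i else 0 := by
  ext x
  exact exists_congr fun _ => eq_comm

theorem finite_hilbertCube (a₀ : ℤ) (d : ℕ) (a : Fin d → ℤ) : (hilbertCube a₀ d a).Finite := by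
  rw [hilbertCube_eq_range]
  exact Set.finite_range _

theorem hilbertCube_succ (a₀ : ℤ) (d : ℕ) (a : Fin (d + 1) → ℤ) :
    hilbertCube a₀ (d + 1) a = hilbertCube a₀ d (fun i => a i.castSucc) ∪
      (· + a (Fin.last d)) '' hilbertCube a₀ d (fun i => a i.castSucc) := by
  ext x
  constructor
  · rintro ⟨ε, rfl⟩
    rw [Fin.sum_univ_castSucc]
    cases h : ε (Fin.last d)
    · exact Or.inl ⟨fun i => ε i.castSucc, by simp⟩
    · exact Or.inr ⟨_, ⟨fun i => ε i.castSucc, rfl⟩, by simp [add_assoc]⟩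
  · rintro (⟨ε, rfl⟩ | ⟨_, ⟨ε, rfl⟩, rfl⟩)
    · exact ⟨Fin.snoc ε false, by simp [Fin.sum_univ_castSucc]⟩
    · exact ⟨Fin.snoc ε true, by simp [Fin.sum_univ_castSucc, add_assoc]⟩

/-- A finite set of integers without `k`-term progressions of difference `r` grows by a factor of
at least `k / (k - 1)` when united with its translate by `r`. -/
theorem mul_card_le_mul_card_union_image_add {k : ℕ} (hk : 1 ≤ k) (A : Finset ℤ) (r : ℤ)
    (hA : ∀ b : ℤ, ∃ i < k, b + (i : ℤ) * r ∉ A) :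
    k * A.card ≤ (k - 1) * (A ∪ A.image (· + r)).card := by
  classical
  set T := A.image (· + r) \ A with hT
  have hsub : A ⊆ (T ×ˢ Finset.Icc 1 (k - 1)).image fun p => p.1 - (p.2 : ℤ) * r := by
    intro x hx
    have hex : ∃ i : ℕ, x + (i : ℤ) * r ∉ A := let ⟨i, _, hi⟩ := hA x; ⟨i, hi⟩
    have hlt : Nat.find hex < k := by
      obtain ⟨i, hik, hi⟩ := hA x
      exact (Nat.find_min' hex hi).trans_lt hik
    have hspec := Nat.find_spec hex
    have hmin := fun m => @Nat.find_min _ _ hex m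
    generalize Nat.find hex = j at hlt hspec hmin
    obtain _ | j := j
    · simp [hx] at hspec
    have hj : x + (j : ℤ) * r ∈ A := not_not.mp (hmin j j.lt_succ_self)
    refine Finset.mem_image.mpr ⟨(x + ((j + 1 : ℕ) : ℤ) * r, j + 1), ?_, by simp⟩
    refine Finset.mem_product.mpr ⟨?_, Finset.mem_Icc.mpr ⟨by omega, by simp only; omega⟩⟩
    refine Finset.mem_sdiff.mpr ⟨Finset.mem_image.mpr ⟨_, hj, ?_⟩, hspec⟩
    push_cast
    ring
  have hcard : A.card ≤ T.card * (k - 1) := by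
    simpa [Finset.card_product] using (Finset.card_le_card hsub).trans Finset.card_image_le
  have hunion : (A ∪ A.image (· + r)).card = A.card + T.card := by
    rw [← Finset.union_sdiff_self_eq_union, Finset.card_union_of_disjoint Finset.disjoint_sdiff]
  obtain ⟨m, rfl⟩ := Nat.exists_eq_add_of_le' hk
  simp only [Nat.add_sub_cancel] at hcard ⊢
  rw [hunion]
  nlinarith

theorem ncard_hilbertCube_mul_le {k : ℕ} (hk : 2 ≤ k) {S : Set ℤ}
    (hS : ¬ ∃ b r : ℤ, r ≠ 0 ∧ ∀ i : ℕ, i < k → b + (i : ℤ) * r ∈ S)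
    (d : ℕ) (a₀ : ℤ) (a : Fin (d + 1) → ℤ) (ha : a (Fin.last d) ≠ 0)
    (hcube : hilbertCube a₀ d (fun i => a i.castSucc) ⊆ S) :
    ((hilbertCube a₀ d (fun i => a i.castSucc)).ncard : ℝ) * ((k : ℝ) / ((k : ℝ) - 1)) ≤
      ((hilbertCube a₀ (d + 1) a).ncard : ℝ) := by
  classical
  rw [hilbertCube_succ]
  obtain ⟨A, hA⟩ := (finite_hilbertCube a₀ d (fun i => a i.castSucc)).exists_finset_coe
  rw [← hA] at hcube ⊢
  have key := mul_card_le_mul_card_union_image_add (k := k) (by omega) A (a (Fin.last d)) (by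
    intro b
    by_contra! h
    exact hS ⟨b, _, ha, fun i hi => hcube (h i hi)⟩)
  rw [← Finset.coe_image, ← Finset.coe_union, Set.ncard_coe_finset, Set.ncard_coe_finset]
  have hk' : (2 : ℝ) ≤ k := by exact_mod_cast hk
  have key' : (k : ℝ) * A.card ≤ (k - 1) * (A ∪ A.image (· + a (Fin.last d))).card := by
    have := (Nat.cast_le (α := ℝ)).mpr key
    rwa [Nat.cast_mul, Nat.cast_mul, Nat.cast_sub (by omega), Nat.cast_one] at this
  rw [← mul_div_assoc, div_le_iff₀ (by linarith)]
  linarith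

theorem stmt0 (k : ℕ) (hk : 3 ≤ k) (S : Set ℤ)
    (hS : ¬ ∃ b r : ℤ, r ≠ 0 ∧ ∀ i : ℕ, i < k → b + (i : ℤ) * r ∈ S)
    (d₁ d₂ : ℕ) (a₀ : ℤ) (a : Fin (d₁ + d₂) → ℤ) (ha : ∀ i, a i ≠ 0)
    (hcube : hilbertCube a₀ (d₁ + d₂) a ⊆ S)
    (C : ℝ)
    (hC : ∀ (b₀ : ℤ) (b : Fin d₁ → ℤ), (∀ i, b i ≠ 0) →
      hilbertCube b₀ d₁ b ⊆ S → C ≤ ((hilbertCube b₀ d₁ b).ncard : ℝ)) :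
    ⌈C * ((k : ℝ) / ((k : ℝ) - 1)) ^ d₂⌉ ≤ ((hilbertCube a₀ (d₁ + d₂) a).ncard : ℤ) := by
  rw [Int.ceil_le, Int.cast_natCast]
  induction d₂ with
  | zero => simpa using hC a₀ a ha hcube
  | succ n ih =>
    have hsub : hilbertCube a₀ (d₁ + n) (fun i => a i.castSucc) ⊆ S :=
      (Set.subset_union_left.trans (hilbertCube_succ a₀ (d₁ + n) a).ge).trans hcube
    have hk' : (3 : ℝ) ≤ k := by exact_mod_cast hk
    have hq : 0 ≤ (k : ℝ) / ((k : ℝ) - 1) := div_nonneg (by linarith) (by linarith)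
    rw [pow_succ, ← mul_assoc]
    exact (mul_le_mul_of_nonneg_right (ih _ (fun i => ha i.castSucc) hsub) hq).trans
      (ncard_hilbertCube_mul_le (by omega) hS (d₁ + n) a₀ a (ha _) hsub)
end

section
/- For every positive integer p, there exist infinitely many pairs (a₁, a₂) of positive integers such that all four numbers p², p² + a₁, p² + a₂, p² + a₁ + a₂ are perfect squares; that is, for any fixed square a₀ = p² there are infinitely many Hilbert cubes H(a₀; a₁, a₂) of dimension 2 contained in the set of squares. -/
theorem stmt1 (p : ℕ) (hp : 0 < p) :
    {q : ℕ × ℕ | 0 < q.1 ∧ 0 < q.2 ∧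
      IsSquare (p ^ 2 + q.1) ∧ IsSquare (p ^ 2 + q.2) ∧
      IsSquare (p ^ 2 + q.1 + q.2)}.Infinite := by
  -- With `x = p + 2k + 1` and `x² - p² = 2y + 1`, we have `x² + y² = p² + (y + 1)²`.
  let d : ℕ → ℕ := fun n ↦ 2 * (n + 1) * (p + n + 2)
  let a : ℕ → ℕ := fun n ↦ (2 * n + 3) * (2 * p + 2 * n + 3)
  have ha : StrictMono a := strictMono_nat_of_lt_succ fun n ↦ by
    simp only [a]
    gcongr <;> omega
  refine Set.infinite_of_injective_forall_mem (f := fun n ↦ (a n, d n * (2 * p + d n)))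
    (fun m n h ↦ ha.injective (congrArg Prod.fst h)) fun n ↦ ⟨?_, ?_, ?_, ?_, ?_⟩
  · positivity
  · positivity
  · exact ⟨p + 2 * n + 3, by simp only [a]; ring⟩
  · exact ⟨p + d n, by ring⟩
  · exact ⟨p + d n + 1, by simp only [a, d]; ring⟩
end

section
/- Let a₀ and a₁ be positive integers. Then the set {a₂ ∈ ℕ : a₂ > 0, a₀ + a₂ is a perfect square, and a₀ + a₁ + a₂ is a perfect square} is finite and has at most τ(a₁) elements, where τ(a₁) is the number of positive divisors of a₁. -/
/-- If `x² + a = y²` with `0 < a`, then `y - x` is a positive divisor of `a`, with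
cofactor `y + x`. -/
theorem exists_pos_eq_add_and_mul_eq {a x y : ℕ} (ha : 0 < a) (h : x * x + a = y * y) :
    ∃ d, 0 < d ∧ y = x + d ∧ d * (2 * x + d) = a := by
  have hxy : x < y := by
    by_contra! hle
    have := Nat.mul_le_mul hle hle
    omega
  obtain ⟨d, rfl⟩ := Nat.exists_eq_add_of_lt hxy
  exact ⟨d + 1, d.succ_pos, by ring, by linarith⟩

theorem stmt3 (a₀ a₁ : ℕ) (h₀ : 0 < a₀) (h₁ : 0 < a₁) :
    {a₂ : ℕ | 0 < a₂ ∧ IsSquare (a₀ + a₂) ∧ IsSquare (a₀ + a₁ + a₂)}.Finite ∧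
    {a₂ : ℕ | 0 < a₂ ∧ IsSquare (a₀ + a₂) ∧ IsSquare (a₀ + a₁ + a₂)}.ncard ≤
      a₁.divisors.card := by
  set S := {a₂ : ℕ | 0 < a₂ ∧ IsSquare (a₀ + a₂) ∧ IsSquare (a₀ + a₁ + a₂)}
  let f : ℕ → ℕ := fun a₂ ↦ Nat.sqrt (a₀ + a₁ + a₂) - Nat.sqrt (a₀ + a₂)
  have key : ∀ b ∈ S, ∃ x, a₀ + b = x * x ∧ 0 < f b ∧ f b * (2 * x + f b) = a₁ := by
    rintro b ⟨-, ⟨x, hx⟩, ⟨y, hy⟩⟩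
    obtain ⟨d, hd, rfl, hmul⟩ :=
      exists_pos_eq_add_and_mul_eq h₁ (show x * x + a₁ = y * y by omega)
    have hf : f b = d := by simp [f, hx, hy, Nat.sqrt_eq]
    exact ⟨x, hx, hf ▸ hd, hf ▸ hmul⟩
  have hmaps : Set.MapsTo f S (a₁.divisors : Set ℕ) := by
    intro b hb
    obtain ⟨x, -, -, hmul⟩ := key b hb
    exact Nat.mem_divisors.2 ⟨⟨_, hmul.symm⟩, h₁.ne'⟩
  have hinj : Set.InjOn f S := by
    intro b hb c hc hbc
    obtain ⟨x, hx, hpos, hbmul⟩ := key b hb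
    obtain ⟨y, hy, -, hcmul⟩ := key c hc
    rw [← hbc] at hcmul
    have := Nat.eq_of_mul_eq_mul_left hpos (hbmul.trans hcmul.symm)
    obtain rfl : x = y := by omega
    omega
  refine ⟨Set.Finite.of_injOn hmaps hinj a₁.divisors.finite_toSet, ?_⟩
  rw [← Set.ncard_coe_finset]
  exact Set.ncard_le_ncard_of_injOn f hmaps hinj a₁.divisors.finite_toSet
end

section
/- Let m ≥ 2 be an integer and let a₀, a₁ be fixed positive integers with a₀ < a₁. Then there are only finitely many Hilbert cubes of dimension m in the set of squares with this base a₀ and first element a₁; that is, the set of tuples (a₂, …, a_m) of positive integers such that H(a₀; a₁, a₂, …, a_m) ⊂ S is finite. -/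
/-- If `n` and `n + d` are both squares with `d > 0`, then `n` is at most `d ^ 2`. -/
theorem le_sq_of_isSquare_of_isSquare_add {n d : ℕ} (hd : 0 < d) (hn : IsSquare n)
    (hnd : IsSquare (n + d)) : n ≤ d ^ 2 := by
  obtain ⟨x, rfl⟩ := hn
  obtain ⟨y, hy⟩ := hnd
  have hxy : x < y := by nlinarith
  have hx : x ≤ d := by nlinarith
  nlinarith

theorem stmt4 (m : ℕ) (hm : 2 ≤ m) (a₀ a₁ : ℕ) (h₀ : 0 < a₀) (h₀₁ : a₀ < a₁) :
    {a : Fin (m - 1) → ℕ | (∀ i, 0 < a i) ∧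
      ∀ (e : Bool) (ε : Fin (m - 1) → Bool),
        IsSquare (a₀ + (if e then a₁ else 0) + ∑ i, if ε i then a i else 0)}.Finite := by
  refine (Set.finite_Iic (fun _ : Fin (m - 1) => a₁ ^ 2)).subset ?_
  rintro a ⟨-, ha⟩ i
  have h_base := ha false (fun j => decide (j = i))
  have h_shift := ha true (fun j => decide (j = i))
  simp only [decide_eq_true_eq, Finset.sum_ite_eq', Finset.mem_univ, if_true, add_zero,
    Bool.false_eq_true, if_false] at h_base h_shift
  rw [add_right_comm] at h_shift
  have := le_sq_of_isSquare_of_isSquare_add (h₀.trans h₀₁) h_base h_shift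
  exact (Nat.le_add_left _ _).trans this
end

section
/- There exist a constant c > 0 and a threshold N₀ such that for all N ≥ N₀, the number of quadruples (a₀, a₁, a₂, a₃) of positive integers with a₀, a₁, a₂, a₃ ≤ N, gcd(a₀, a₁, a₂, a₃) = 1, and all eight sums a₀ + ε₁a₁ + ε₂a₂ + ε₃a₃ (εᵢ ∈ {0,1}) perfect squares, is at least c · N^{1/8}. In particular, there exist infinitely many reduced Hilbert cubes of dimension 3 in the set of squares. -/
/-- If `k` and `q` are coprime of opposite parity, then `2kq + q² - k²`, up to sign the difference
of the legs of the Pythagorean triangle generated by `(k, q)`, is coprime to four times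
the area of the triangle. -/
lemma isCoprime_legs_sub_area {k q : ℤ} (h : IsCoprime k q) (hodd : Odd (k + q)) :
    IsCoprime (2 * k * q + q ^ 2 - k ^ 2) (4 * k * q * (k - q) * (k + q)) := by
  have h2 : IsCoprime (k + q) 2 := by
    obtain ⟨j, hj⟩ := hodd
    exact ⟨1, -j, by rw [hj]; ring⟩
  have hr2 : IsCoprime (2 * k * q + q ^ 2 - k ^ 2) 2 := by
    rw [show 2 * k * q + q ^ 2 - k ^ 2 = (k + q) ^ 2 + 2 * (-k ^ 2) by ring]
    exact (h2.pow_left (m := 2)).add_mul_left_left (-k ^ 2)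
  have hrk : IsCoprime (2 * k * q + q ^ 2 - k ^ 2) k := by
    rw [show 2 * k * q + q ^ 2 - k ^ 2 = q ^ 2 + k * (2 * q - k) by ring]
    exact (h.symm.pow_left (m := 2)).add_mul_left_left (2 * q - k)
  have hrq : IsCoprime (2 * k * q + q ^ 2 - k ^ 2) q := by
    rw [show 2 * k * q + q ^ 2 - k ^ 2 = -k ^ 2 + q * (2 * k + q) by ring]
    exact (h.pow_left (m := 2)).neg_left.add_mul_left_left (2 * k + q)
  have hkm : IsCoprime k (k - q) := by
    rw [show k - q = -q + k * 1 by ring]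
    exact h.neg_right.add_mul_left_right 1
  have hkp : IsCoprime k (k + q) := by
    rw [show k + q = q + k * 1 by ring]
    exact h.add_mul_left_right 1
  have hm2 : IsCoprime 2 (k - q) := by
    rw [show k - q = k + q + 2 * (-q) by ring]
    exact h2.symm.add_mul_left_right (-q)
  have hrm : IsCoprime (2 * k * q + q ^ 2 - k ^ 2) (k - q) := by
    rw [show 2 * k * q + q ^ 2 - k ^ 2 = 2 * k ^ 2 + -(3 * k + q) * (k - q) by ring]
    exact (hm2.mul_left (hkm.pow_left (m := 2))).add_mul_right_left (-(3 * k + q))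
  have hrp : IsCoprime (2 * k * q + q ^ 2 - k ^ 2) (k + q) := by
    rw [show 2 * k * q + q ^ 2 - k ^ 2 = -(2 * k ^ 2) + (q + k) * (k + q) by ring]
    exact (h2.symm.mul_left (hkp.pow_left (m := 2))).neg_left.add_mul_right_left (q + k)
  have h4 : IsCoprime (2 * k * q + q ^ 2 - k ^ 2) 4 := by
    have := hr2.mul_right hr2
    norm_num at this
    exact this
  exact (((h4.mul_right hrk).mul_right hrq).mul_right hrm).mul_right hrp

namespace HilbertCube

/-- Square root of the base of the `t`-th cube. The cubes come from the two Pythagorean triangles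
of equal area generated by `(m² + m + 1, 2m + 1)` and `(m² + m + 1, m² - 1)`,
where `m = 6t + 9`. -/
def baseRoot (t : ℕ) : ℕ := 1296 * t ^ 4 + 7344 * t ^ 3 + 15300 * t ^ 2 + 13776 * t + 4462

/-- Four times the common area of the two triangles, the common difference of
two three-term progressions of squares. -/
def diff (t : ℕ) : ℕ :=
  4 * (36 * t ^ 2 + 114 * t + 91) * (36 * t ^ 2 + 108 * t + 80) * (6 * t + 11) *
    (72 * t ^ 2 + 222 * t + 171)

/-- The difference of the square roots of the first terms of the two progressions. -/
def rootGap (t : ℕ) : ℕ := 1296 * t ^ 4 + 8208 * t ^ 3 + 19512 * t ^ 2 + 20652 * t + 8217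

/-- The difference of the first terms of the two progressions. -/
def shift (t : ℕ) : ℕ := rootGap t * (rootGap t + 2 * baseRoot t)

/-- The base and elements of the `t`-th cube. -/
def cube (t : ℕ) : ℕ × ℕ × ℕ × ℕ := (baseRoot t ^ 2, diff t, diff t, shift t)

lemma base_add_shift (t : ℕ) : baseRoot t ^ 2 + shift t = (baseRoot t + rootGap t) ^ 2 := by
  unfold shift
  ring

lemma base_add_diff (t : ℕ) : baseRoot t ^ 2 + diff t =
    (1296 * t ^ 4 + 8208 * t ^ 3 + 19692 * t ^ 2 + 21204 * t + 8642) ^ 2 := by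
  unfold baseRoot diff
  ring

lemma base_add_diff_add_diff (t : ℕ) : baseRoot t ^ 2 + diff t + diff t =
    (1296 * t ^ 4 + 9072 * t ^ 3 + 23508 * t ^ 2 + 26808 * t + 11378) ^ 2 := by
  unfold baseRoot diff
  ring

lemma base_add_diff_add_shift (t : ℕ) : baseRoot t ^ 2 + diff t + shift t =
    (2592 * t ^ 4 + 15984 * t ^ 3 + 36972 * t ^ 2 + 38028 * t + 14681) ^ 2 := by
  unfold shift baseRoot diff rootGap
  ring

lemma base_add_diff_add_diff_add_shift (t : ℕ) :
    baseRoot t ^ 2 + diff t + diff t + shift t =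
      (2592 * t ^ 4 + 16416 * t ^ 3 + 39060 * t ^ 2 + 41364 * t + 16441) ^ 2 := by
  unfold shift baseRoot diff rootGap
  ring

lemma isSquare_cube (t : ℕ) (ε₁ ε₂ ε₃ : Bool) :
    IsSquare ((cube t).1 + (if ε₁ then (cube t).2.1 else 0) +
      (if ε₂ then (cube t).2.2.1 else 0) + (if ε₃ then (cube t).2.2.2 else 0)) := by
  cases ε₁ <;> cases ε₂ <;> cases ε₃ <;>
    simp only [cube, Bool.false_eq_true, if_true, if_false, add_zero]
  · exact .sq _
  · exact ⟨_, (base_add_shift t).trans (sq _)⟩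
  · exact ⟨_, (base_add_diff t).trans (sq _)⟩
  · exact ⟨_, (base_add_diff_add_shift t).trans (sq _)⟩
  · exact ⟨_, (base_add_diff t).trans (sq _)⟩
  · exact ⟨_, (base_add_diff_add_shift t).trans (sq _)⟩
  · exact ⟨_, (base_add_diff_add_diff t).trans (sq _)⟩
  · exact ⟨_, (base_add_diff_add_diff_add_shift t).trans (sq _)⟩

lemma gcd_cube (t : ℕ) :
    Nat.gcd (cube t).1 (Nat.gcd (cube t).2.1 (Nat.gcd (cube t).2.2.1 (cube t).2.2.2)) = 1 := by
  have hkq : IsCoprime (36 * (t : ℤ) ^ 2 + 114 * t + 91) (36 * (t : ℤ) ^ 2 + 108 * t + 80) := by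
    refine ⟨2 * t + 4 - ((2 * t + 4) * (6 * t + 8) + 1), (2 * t + 4) * (6 * t + 8) + 1, ?_⟩
    ring
  have hodd : Odd ((36 * (t : ℤ) ^ 2 + 114 * t + 91) + (36 * (t : ℤ) ^ 2 + 108 * t + 80)) :=
    ⟨36 * t ^ 2 + 111 * t + 85, by ring⟩
  have hcop : Nat.Coprime (baseRoot t + rootGap t) (diff t) := by
    rw [← Nat.isCoprime_iff_coprime]
    convert isCoprime_legs_sub_area hkq hodd using 2
    · simp only [baseRoot, rootGap]
      push_cast
      ring
    · simp only [diff]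
      push_cast
      ring
  have hcop' : Nat.Coprime (baseRoot t ^ 2 + shift t) (diff t) := by
    rw [base_add_shift]
    exact hcop.pow_left 2
  let g := Nat.gcd (cube t).1 (Nat.gcd (cube t).2.1 (Nat.gcd (cube t).2.2.1 (cube t).2.2.2))
  have hg : g ∣ Nat.gcd (cube t).2.1 (Nat.gcd (cube t).2.2.1 (cube t).2.2.2) :=
    Nat.gcd_dvd_right _ _
  exact Nat.eq_one_of_dvd_coprimes hcop'
    (Nat.dvd_add (Nat.gcd_dvd_left _ _)
      (hg.trans ((Nat.gcd_dvd_right _ _).trans (Nat.gcd_dvd_right _ _))))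
    (hg.trans (Nat.gcd_dvd_left _ _))

lemma baseRoot_strictMono : StrictMono baseRoot := by
  intro a b hab
  unfold baseRoot
  gcongr

lemma cube_injective : Function.Injective cube := by
  intro a b hab
  exact baseRoot_strictMono.injective (Nat.pow_left_injective two_ne_zero (congrArg Prod.fst hab))

lemma quartic_sq_le {n t a b c d e : ℕ}
    (hn : n ≤ (a * t ^ 4 + b * t ^ 3 + c * t ^ 2 + d * t + e) ^ 2)
    (ha : a + b + c + d + e ≤ 100 ^ 4) : n ≤ (100 * (t + 1)) ^ 8 := by
  have h : a * t ^ 4 + b * t ^ 3 + c * t ^ 2 + d * t + e ≤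
      (a + b + c + d + e) * (t + 1) ^ 4 := by
    have hpow (i : ℕ) (hi : i ≤ 4) : t ^ i ≤ (t + 1) ^ 4 :=
      (Nat.pow_le_pow_left t.le_succ i).trans (Nat.pow_le_pow_right t.succ_pos hi)
    linarith [Nat.mul_le_mul_left a (hpow 4 (by simp)), Nat.mul_le_mul_left b (hpow 3 (by simp)),
      Nat.mul_le_mul_left c (hpow 2 (by simp)), Nat.mul_le_mul_left d (hpow 1 (by simp)),
      Nat.mul_le_mul_left e (hpow 0 (by simp))]
  calc n ≤ _ := hn
    _ ≤ (100 ^ 4 * (t + 1) ^ 4) ^ 2 := by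
        gcongr
        exact h.trans (Nat.mul_le_mul_right _ ha)
    _ = _ := by ring

lemma sum_cube_le (t : ℕ) :
    baseRoot t ^ 2 + diff t + diff t + shift t ≤ (100 * (t + 1)) ^ 8 :=
  quartic_sq_le (base_add_diff_add_diff_add_shift t).le (by norm_num)

end HilbertCube

open HilbertCube

theorem stmt5 :
    ∃ c : ℝ, 0 < c ∧ ∃ N₀ : ℕ, ∀ N : ℕ, N₀ ≤ N →
      c * (N : ℝ) ^ ((1 : ℝ) / 8) ≤
        ({q : ℕ × ℕ × ℕ × ℕ |
          0 < q.1 ∧ 0 < q.2.1 ∧ 0 < q.2.2.1 ∧ 0 < q.2.2.2 ∧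
          q.1 ≤ N ∧ q.2.1 ≤ N ∧ q.2.2.1 ≤ N ∧ q.2.2.2 ≤ N ∧
          Nat.gcd q.1 (Nat.gcd q.2.1 (Nat.gcd q.2.2.1 q.2.2.2)) = 1 ∧
          ∀ ε₁ ε₂ ε₃ : Bool,
            IsSquare (q.1 + (if ε₁ then q.2.1 else 0) + (if ε₂ then q.2.2.1 else 0) +
              (if ε₃ then q.2.2.2 else 0))}.ncard : ℝ) := by
  refine ⟨1 / 200, by norm_num, 100 ^ 8, fun N hN => ?_⟩
  set A : Set (ℕ × ℕ × ℕ × ℕ) := {q | _} with hA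
  have hfin : A.Finite := by
    refine (Set.finite_Iic (N, N, N, N)).subset ?_
    rintro q ⟨-, -, -, -, h₀, h₁, h₂, h₃, -⟩
    exact ⟨h₀, h₁, h₂, h₃⟩
  set x : ℝ := (N : ℝ) ^ ((1 : ℝ) / 8) with hx
  have hx8 : x ^ 8 = N := by
    rw [hx, ← Real.rpow_natCast, ← Real.rpow_mul (Nat.cast_nonneg N)]
    norm_num
  have hx0 : 0 ≤ x := by positivity
  have hx100 : 100 ≤ x := by
    refine le_of_pow_le_pow_left₀ (n := 8) (by norm_num) hx0 ?_
    rw [hx8]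
    exact_mod_cast hN
  set T := ⌊x / 100⌋₊ with hT
  have hTx : 100 * (T : ℝ) ≤ x := by
    have := Nat.floor_le (a := x / 100) (by positivity)
    linarith
  have hT_lower : 1 / 200 * x ≤ T := by
    have h₁ : (1 : ℝ) ≤ T := by
      exact_mod_cast Nat.le_floor (a := x / 100) (n := 1) (by norm_num; linarith)
    have h₂ := Nat.lt_floor_add_one (x / 100)
    rw [← hT] at h₂
    linarith
  have hTN : (100 * T) ^ 8 ≤ N := by
    have : (100 * (T : ℝ)) ^ 8 ≤ N := hx8 ▸ pow_le_pow_left₀ (by positivity) hTx 8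
    exact_mod_cast this
  have hsub : cube '' (Set.Iio T) ⊆ A := by
    rintro _ ⟨t, ht, rfl⟩
    have hle : baseRoot t ^ 2 + diff t + diff t + shift t ≤ N :=
      (sum_cube_le t).trans <| (Nat.pow_le_pow_left (Nat.mul_le_mul_left 100 ht) 8).trans hTN
    refine ⟨?_, ?_, ?_, ?_, ?_, ?_, ?_, ?_, gcd_cube t, isSquare_cube t⟩
    · simp only [cube, baseRoot]; positivity
    · simp only [cube, diff]; positivity
    · simp only [cube, diff]; positivity
    · simp only [cube, shift, rootGap]; positivity
    all_goals
      simp only [cube]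
      omega
  have hcard : T ≤ A.ncard := by
    have := Set.ncard_le_ncard hsub hfin
    rwa [Set.ncard_image_of_injective _ cube_injective, ← Finset.coe_Iio, Set.ncard_coe_finset,
      Nat.card_Iio] at this
  exact hT_lower.trans (by exact_mod_cast hcard)
end

section
/- There exist a constant c > 0 and a threshold N₀ such that for all N ≥ N₀, the number of triples (a₀, a₁, a₃) of positive integers with a₀, a₁, a₃ ≤ N, a₁ < a₃, gcd(a₀, a₁, a₃) = 1, and all of a₀, a₀ + a₁, a₀ + 2a₁, a₀ + a₃, a₀ + a₁ + a₃, a₀ + 2a₁ + a₃ perfect squares (i.e. H(a₀; a₁, a₁, a₃) ⊂ S with a₁ = a₂ < a₃) is at least c · N^{1/10}. In particular, there exist infinitely many reduced Hilbert cubes H(a₀; a₁, a₂, a₃) of dimension 3 in the set of squares with a₁ = a₂ < a₃. -/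
/-- The square root of the base of the `j`-th Hilbert cube. With `u = 18 j ^ 2 + 45 j + 28` and
`v = 18 j ^ 2 + 33 j + 15` this is `2 u v - (u ^ 2 - v ^ 2)`. -/
def cubeBaseRoot (j : ℕ) : ℕ := 648 * j ^ 4 + 2376 * j ^ 3 + 3114 * j ^ 2 + 1668 * j + 281

/-- The repeated element `4 u v (u ^ 2 - v ^ 2)` of the `j`-th Hilbert cube. -/
def cubeStep (j : ℕ) : ℕ :=
  4 * (18 * j ^ 2 + 45 * j + 28) * (18 * j ^ 2 + 33 * j + 15) *
    ((12 * j + 13) * (36 * j ^ 2 + 78 * j + 43))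

/-- The last element of the `j`-th Hilbert cube. It is `(s ^ 2 + t ^ 2) ^ 2 - (u ^ 2 + v ^ 2) ^ 2`
with `s = 36 j ^ 2 + 75 j + 39` and `t = 3 j + 4`, where `(s, t)` and `(u, v)` generate Pythagorean
triangles of equal area. -/
def cubeShift (j : ℕ) : ℕ :=
  (648 * j ^ 4 + 2592 * j ^ 3 + 3780 * j ^ 2 + 2364 * j + 528) *
    (1944 * j ^ 4 + 8208 * j ^ 3 + 13104 * j ^ 2 + 9384 * j + 2546)

lemma strictMono_cubeBaseRoot : StrictMono cubeBaseRoot := by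
  intro i j h
  unfold cubeBaseRoot
  gcongr

lemma cubeStep_lt_cubeShift (j : ℕ) : cubeStep j < cubeShift j := by
  have h : cubeShift j = cubeStep j +
      (1259712 * j ^ 8 + 9797760 * j ^ 7 + 32869152 * j ^ 6 + 61896960 * j ^ 5 + 71169840 * j ^ 4 +
        50712264 * j ^ 3 + 21530844 * j ^ 2 + 4827732 * j + 405168) := by
    unfold cubeShift cubeStep
    ring
  omega

lemma coprime_cubeBaseRoot_cubeStep (j : ℕ) : Nat.Coprime (cubeBaseRoot j) (cubeStep j) := by
  rw [← Nat.isCoprime_iff_coprime]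
  unfold cubeBaseRoot cubeStep
  push_cast
  generalize (j : ℤ) = x
  set u : ℤ := 18 * x ^ 2 + 45 * x + 28 with hu
  set v : ℤ := 18 * x ^ 2 + 33 * x + 15 with hv
  have hA : (648 * x ^ 4 + 2376 * x ^ 3 + 3114 * x ^ 2 + 1668 * x + 281 : ℤ) =
      2 * u * v - (u ^ 2 - v ^ 2) := by rw [hu, hv]; ring
  have hd : 12 * x + 13 = u - v := by rw [hu, hv]; ring
  have hs : 36 * x ^ 2 + 78 * x + 43 = u + v := by rw [hu, hv]; ring
  rw [hA, hd, hs]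
  have huv : IsCoprime u v := by
    have h₁ : IsCoprime (u - v) (3 * (x + 1)) := ⟨1, -4, by rw [← hd]; ring⟩
    have h₂ : IsCoprime (u - v) (6 * x + 5) :=
      ⟨2 * (x + 1), -(4 * (x + 1)) - 1, by rw [← hd]; ring⟩
    have h₃ := h₁.mul_right h₂
    rw [show 3 * (x + 1) * (6 * x + 5) = v by rw [hv]; ring] at h₃
    simpa using h₃.add_mul_right_left 1
  have h2 : IsCoprime (2 * u * v - (u ^ 2 - v ^ 2)) (2 : ℤ) :=
    ⟨1, -(324 * x ^ 4 + 1188 * x ^ 3 + 1557 * x ^ 2 + 834 * x + 140), by rw [← hA]; ring⟩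
  have hu' : IsCoprime (2 * u * v - (u ^ 2 - v ^ 2)) u := by
    rw [show 2 * u * v - (u ^ 2 - v ^ 2) = v ^ 2 + u * (2 * v - u) by ring]
    exact (huv.symm.pow_left (m := 2)).add_mul_left_left (2 * v - u)
  have hv' : IsCoprime (2 * u * v - (u ^ 2 - v ^ 2)) v := by
    rw [show 2 * u * v - (u ^ 2 - v ^ 2) = -u ^ 2 + v * (2 * u + v) by ring]
    exact (huv.pow_left (m := 2)).neg_left.add_mul_left_left (2 * u + v)
  have hdu : IsCoprime u (u - v) := by
    simpa [sub_eq_add_neg, add_comm] using huv.neg_right.add_mul_left_right 1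
  have hsu : IsCoprime u (u + v) := by
    simpa [add_comm] using huv.add_mul_left_right 1
  have h2d : IsCoprime 2 (u - v) :=
    ⟨-(6 * x + 6), 1, by rw [← hd]; ring⟩
  have h2s : IsCoprime 2 (u + v) :=
    ⟨-(18 * x ^ 2 + 39 * x + 21), 1, by rw [← hs]; ring⟩
  have hd' : IsCoprime (2 * u * v - (u ^ 2 - v ^ 2)) (u - v) := by
    rw [show 2 * u * v - (u ^ 2 - v ^ 2) = 2 * u ^ 2 + (u - v) * (-(2 * u) - (u + v)) by ring]
    exact (h2d.mul_left (hdu.pow_left (m := 2))).add_mul_left_left (-(2 * u) - (u + v))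
  have hs' : IsCoprime (2 * u * v - (u ^ 2 - v ^ 2)) (u + v) := by
    rw [show 2 * u * v - (u ^ 2 - v ^ 2) = -(2 * u ^ 2) + (u + v) * (2 * u - (u - v)) by ring]
    exact (h2s.mul_left (hsu.pow_left (m := 2))).neg_left.add_mul_left_left (2 * u - (u - v))
  have h4 := h2.mul_right h2
  norm_num at h4
  exact ((h4.mul_right hu').mul_right hv').mul_right (hd'.mul_right hs')

lemma cubeBaseRoot_sq_le (j : ℕ) : cubeBaseRoot j ^ 2 ≤ (1800 * (j + 1) ^ 4) ^ 2 := by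
  gcongr
  unfold cubeBaseRoot
  ring_nf
  omega

lemma cubeShift_le (j : ℕ) : cubeShift j ≤ (1800 * (j + 1) ^ 4) ^ 2 := by
  unfold cubeShift
  calc _ ≤ (648 * (j + 1) ^ 4) * (2736 * (j + 1) ^ 4) := by
        gcongr <;> ring_nf <;> omega
    _ ≤ _ := by ring_nf; omega

lemma isSquare_cube (j : ℕ) :
    IsSquare (cubeBaseRoot j ^ 2 + cubeStep j) ∧
    IsSquare (cubeBaseRoot j ^ 2 + 2 * cubeStep j) ∧
    IsSquare (cubeBaseRoot j ^ 2 + cubeShift j) ∧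
    IsSquare (cubeBaseRoot j ^ 2 + cubeStep j + cubeShift j) ∧
    IsSquare (cubeBaseRoot j ^ 2 + 2 * cubeStep j + cubeShift j) := by
  unfold cubeBaseRoot cubeStep cubeShift
  refine ⟨⟨648 * j ^ 4 + 2808 * j ^ 3 + 4662 * j ^ 2 + 3510 * j + 1009, ?_⟩,
    ⟨648 * j ^ 4 + 3240 * j ^ 3 + 5922 * j ^ 2 + 4728 * j + 1399, ?_⟩,
    ⟨1296 * j ^ 4 + 5184 * j ^ 3 + 7686 * j ^ 2 + 4992 * j + 1193, ?_⟩,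
    ⟨1296 * j ^ 4 + 5400 * j ^ 3 + 8442 * j ^ 2 + 5874 * j + 1537, ?_⟩,
    ⟨1296 * j ^ 4 + 5616 * j ^ 3 + 9162 * j ^ 2 + 6660 * j + 1817, ?_⟩⟩ <;> ring

theorem stmt6 :
    ∃ c : ℝ, 0 < c ∧ ∃ N₀ : ℕ, ∀ N : ℕ, N₀ ≤ N →
      c * (N : ℝ) ^ ((1 : ℝ) / 10) ≤
        ({q : ℕ × ℕ × ℕ |
          0 < q.1 ∧ 0 < q.2.1 ∧ 0 < q.2.2 ∧
          q.1 ≤ N ∧ q.2.1 ≤ N ∧ q.2.2 ≤ N ∧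
          q.2.1 < q.2.2 ∧
          Nat.gcd q.1 (Nat.gcd q.2.1 q.2.2) = 1 ∧
          IsSquare q.1 ∧ IsSquare (q.1 + q.2.1) ∧ IsSquare (q.1 + 2 * q.2.1) ∧
          IsSquare (q.1 + q.2.2) ∧ IsSquare (q.1 + q.2.1 + q.2.2) ∧
          IsSquare (q.1 + 2 * q.2.1 + q.2.2)}.ncard : ℝ) := by
  refine ⟨1 / 2, by norm_num, 1800 ^ 10, fun N hN => ?_⟩
  set x : ℝ := (N : ℝ) ^ ((1 : ℝ) / 10) with hx
  have hx0 : 0 ≤ x := by positivity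
  have hxN : x ^ 10 = N := by
    rw [hx, ← Real.rpow_natCast, ← Real.rpow_mul (Nat.cast_nonneg N)]
    norm_num
  have hx1 : 1800 ≤ x := by
    refine le_of_pow_le_pow_left₀ (n := 10) (by norm_num) hx0 ?_
    rw [hxN]
    exact_mod_cast hN
  set K : ℕ := ⌊x⌋₊ with hK
  have hK1 : 1800 ≤ K := Nat.le_floor (by exact_mod_cast hx1)
  have hKN : K ^ 10 ≤ N := by
    have h : (K : ℝ) ^ 10 ≤ N := by
      rw [← hxN]
      gcongr
      exact Nat.floor_le hx0
    exact_mod_cast h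
  set S := {q : ℕ × ℕ × ℕ |
          0 < q.1 ∧ 0 < q.2.1 ∧ 0 < q.2.2 ∧
          q.1 ≤ N ∧ q.2.1 ≤ N ∧ q.2.2 ≤ N ∧
          q.2.1 < q.2.2 ∧
          Nat.gcd q.1 (Nat.gcd q.2.1 q.2.2) = 1 ∧
          IsSquare q.1 ∧ IsSquare (q.1 + q.2.1) ∧ IsSquare (q.1 + 2 * q.2.1) ∧
          IsSquare (q.1 + q.2.2) ∧ IsSquare (q.1 + q.2.1 + q.2.2) ∧
          IsSquare (q.1 + 2 * q.2.1 + q.2.2)} with hS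
  have hfin : S.Finite :=
    (Set.finite_Iic (N, N, N)).subset fun q hq => ⟨hq.2.2.2.1, hq.2.2.2.2.1, hq.2.2.2.2.2.1⟩
  let f : ℕ → ℕ × ℕ × ℕ := fun j => (cubeBaseRoot j ^ 2, cubeStep j, cubeShift j)
  have hf : Function.Injective f := fun i j h =>
    strictMono_cubeBaseRoot.injective
      (Nat.pow_left_injective two_ne_zero (congrArg Prod.fst h))
  have hsub : (((Finset.range K).image f : Finset (ℕ × ℕ × ℕ)) : Set (ℕ × ℕ × ℕ)) ⊆ S := by
    intro q hq
    obtain ⟨j, hj, rfl⟩ := Finset.mem_image.mp (Finset.mem_coe.mp hq)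
    have hj : j + 1 ≤ K := Finset.mem_range.mp hj
    have hB : (1800 * (j + 1) ^ 4) ^ 2 ≤ N :=
      calc (1800 * (j + 1) ^ 4) ^ 2 ≤ (K * K ^ 4) ^ 2 := by gcongr
        _ = K ^ 10 := by ring
        _ ≤ N := hKN
    have hlt := cubeStep_lt_cubeShift j
    have hle := (cubeShift_le j).trans hB
    have hgcd : Nat.gcd (cubeBaseRoot j ^ 2) (Nat.gcd (cubeStep j) (cubeShift j)) = 1 :=
      ((coprime_cubeBaseRoot_cubeStep j).pow_left 2).coprime_dvd_right (Nat.gcd_dvd_left _ _)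
    have hbase : 0 < cubeBaseRoot j ^ 2 := by unfold cubeBaseRoot; positivity
    have hstep : 0 < cubeStep j := by unfold cubeStep; positivity
    exact ⟨hbase, hstep, hstep.trans hlt, (cubeBaseRoot_sq_le j).trans hB, hlt.le.trans hle, hle,
      hlt, hgcd, IsSquare.sq _, isSquare_cube j⟩
  have hcard : K ≤ S.ncard := by
    have h := Set.ncard_le_ncard hsub hfin
    rwa [Set.ncard_coe_finset, Finset.card_image_of_injective _ hf, Finset.card_range] at h
  have hcard' : (K : ℝ) ≤ S.ncard := by exact_mod_cast hcard
  have hfloor : x < K + 1 := Nat.lt_floor_add_one x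
  linarith
end

section
/- There exist infinitely many triples (a₀, a₁, a₂) of positive integers with a₁ < a₂ and gcd(a₀, a₁, a₂) = 1 such that all of a₀, a₀ + a₁, a₀ + a₂, a₀ + a₁ + a₂, a₀ + 2a₂, a₀ + a₁ + 2a₂ are perfect squares; that is, there exist infinitely many reduced Hilbert cubes H(a₀; a₁, a₂, a₃) of dimension 3 in the set of squares with a₁ < a₂ = a₃. -/
/-- A primitive Pythagorean triple and the triangle of equal area obtained from it by Fermat's
doubling construction have, after clearing denominators, coprime hypotenuses. -/
theorem isCoprime_doubled_hypotenuse {a b c : ℤ} (h : a ^ 2 + b ^ 2 = c ^ 2)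
    (hab : IsCoprime a b) (hc : Odd c) :
    IsCoprime (2 * c ^ 2 * (a ^ 2 - b ^ 2)) (c ^ 4 + 4 * a ^ 2 * b ^ 2) := by
  have two_of_odd : ∀ {z : ℤ}, Odd z → IsCoprime z 2 := by
    rintro z ⟨k, rfl⟩
    exact ⟨1, -k, by ring⟩
  have hca : IsCoprime c a := by
    rw [← IsCoprime.pow_left_iff two_pos, ← h, show a ^ 2 + b ^ 2 = b ^ 2 + a * a by ring]
    exact hab.symm.pow_left.add_mul_left_left a
  have hcb : IsCoprime c b := by
    rw [← IsCoprime.pow_left_iff two_pos, ← h, show a ^ 2 + b ^ 2 = a ^ 2 + b * b by ring]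
    exact hab.pow_left.add_mul_left_left b
  have hda : IsCoprime (a ^ 2 - b ^ 2) a := by
    rw [show a ^ 2 - b ^ 2 = -b ^ 2 + a * a by ring]
    exact hab.symm.pow_left.neg_left.add_mul_left_left a
  have hdb : IsCoprime (a ^ 2 - b ^ 2) b := by
    rw [show a ^ 2 - b ^ 2 = a ^ 2 + b * -b by ring]
    exact hab.pow_left.add_mul_left_left (-b)
  have hd : Odd (a ^ 2 - b ^ 2) := by
    have : a ^ 2 - b ^ 2 = c ^ 2 - 2 * b ^ 2 := by linarith
    rw [this]
    exact hc.pow.sub_even (even_two_mul _)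
  have h2 : IsCoprime 2 (c ^ 4 + 4 * a ^ 2 * b ^ 2) :=
    (two_of_odd (hc.pow.add_even ⟨2 * a ^ 2 * b ^ 2, by ring⟩)).symm
  have hcy : IsCoprime c (c ^ 4 + 4 * a ^ 2 * b ^ 2) := by
    have : IsCoprime c (2 ^ 2 * a ^ 2 * b ^ 2) :=
      ((two_of_odd hc).pow_right.mul_right hca.pow_right).mul_right hcb.pow_right
    rw [show c ^ 4 + 4 * a ^ 2 * b ^ 2 = 2 ^ 2 * a ^ 2 * b ^ 2 + c * c ^ 3 by ring]
    exact this.add_mul_left_right (c ^ 3)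
  have hdy : IsCoprime (a ^ 2 - b ^ 2) (c ^ 4 + 4 * a ^ 2 * b ^ 2) := by
    have : IsCoprime (a ^ 2 - b ^ 2) (2 ^ 3 * a ^ 2 * b ^ 2) :=
      ((two_of_odd hd).pow_right.mul_right hda.pow_right).mul_right hdb.pow_right
    rw [show c ^ 4 + 4 * a ^ 2 * b ^ 2 =
        2 ^ 3 * a ^ 2 * b ^ 2 + (a ^ 2 - b ^ 2) * (a ^ 2 - b ^ 2) by
      linear_combination -(a ^ 2 + b ^ 2 + c ^ 2) * h]
    exact this.add_mul_left_right (a ^ 2 - b ^ 2)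
  exact (h2.mul_left hcy.pow_left).mul_left hdy

theorem isSquare_of_cast_eq_sq {n : ℕ} {z : ℤ} (h : (n : ℤ) = z ^ 2) : IsSquare n :=
  ⟨z.natAbs, by zify; rw [h, ← sq, sq_abs]⟩

/-- The squares of the sum and difference of the legs and of the hypotenuse form an arithmetic
progression; a triangle and its doubling give two progressions of equal difference. -/
theorem exists_reduced_cube_of_pythagorean {a b c : ℤ} (h : a ^ 2 + b ^ 2 = c ^ 2)
    (hab : IsCoprime a b) (hc : Odd c) (hb : 0 < b) (hba : b < a) (hc0 : 0 < c)
    (hlt : 2 * c ^ 2 * (a ^ 2 - b ^ 2) < c ^ 4 + 4 * a ^ 2 * b ^ 2)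
    (hgap : (c ^ 4 + 4 * a ^ 2 * b ^ 2) ^ 2 <
      (2 * c ^ 2 * (a ^ 2 - b ^ 2)) ^ 2 + 8 * a * b * (c * (a ^ 2 - b ^ 2)) ^ 2) :
    ∃ a₀ a₁ a₂ : ℕ, (a₀ : ℤ) = (2 * c * (a ^ 2 - b ^ 2) * (a - b)) ^ 2 ∧
      0 < a₀ ∧ 0 < a₁ ∧ 0 < a₂ ∧ a₁ < a₂ ∧ Nat.gcd a₀ (Nat.gcd a₁ a₂) = 1 ∧
      IsSquare a₀ ∧ IsSquare (a₀ + a₁) ∧ IsSquare (a₀ + a₂) ∧ IsSquare (a₀ + a₁ + a₂) ∧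
      IsSquare (a₀ + 2 * a₂) ∧ IsSquare (a₀ + a₁ + 2 * a₂) := by
  have ha : 0 < a := hb.trans hba
  have hab' : 0 < a - b := sub_pos.2 hba
  have hd : 0 < a ^ 2 - b ^ 2 := by nlinarith
  have h₁ : 0 < (c ^ 4 + 4 * a ^ 2 * b ^ 2) ^ 2 - (2 * c ^ 2 * (a ^ 2 - b ^ 2)) ^ 2 :=
    sub_pos.2 (pow_lt_pow_left₀ hlt (by positivity) two_ne_zero)
  obtain ⟨a₀, e₀⟩ := Int.eq_ofNat_of_zero_le
    (sq_nonneg (2 * c * (a ^ 2 - b ^ 2) * (a - b)))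
  obtain ⟨a₁, e₁⟩ := Int.eq_ofNat_of_zero_le h₁.le
  obtain ⟨a₂, e₂⟩ := Int.eq_ofNat_of_zero_le
    (show 0 ≤ 8 * a * b * (c * (a ^ 2 - b ^ 2)) ^ 2 by positivity)
  have x₁ : ((a₀ + a₂ : ℕ) : ℤ) = (2 * c ^ 2 * (a ^ 2 - b ^ 2)) ^ 2 := by
    push_cast
    rw [← e₀, ← e₂]
    linear_combination 4 * c ^ 2 * (a ^ 2 - b ^ 2) ^ 2 * h
  have y₁ : ((a₀ + a₁ + a₂ : ℕ) : ℤ) = (c ^ 4 + 4 * a ^ 2 * b ^ 2) ^ 2 := by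
    push_cast at x₁ ⊢
    rw [← e₁]
    linear_combination x₁
  have hy : c ^ 4 + 4 * a ^ 2 * b ^ 2 = (a ^ 2 - b ^ 2) ^ 2 + 8 * a ^ 2 * b ^ 2 := by
    linear_combination -(a ^ 2 + b ^ 2 + c ^ 2) * h
  have hcc : c ^ 4 = (a ^ 2 - b ^ 2) ^ 2 + 4 * a ^ 2 * b ^ 2 := by
    linear_combination hy
  refine ⟨a₀, a₁, a₂, e₀.symm, ?_, ?_, ?_, ?_, ?_, isSquare_of_cast_eq_sq e₀.symm,
    isSquare_of_cast_eq_sq (z := (a ^ 2 - b ^ 2) ^ 2 - 4 * a * b * c ^ 2) ?_,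
    isSquare_of_cast_eq_sq x₁, isSquare_of_cast_eq_sq y₁,
    isSquare_of_cast_eq_sq (z := 2 * c * (a ^ 2 - b ^ 2) * (a + b)) ?_,
    isSquare_of_cast_eq_sq (z := (a ^ 2 - b ^ 2) ^ 2 + 4 * a * b * c ^ 2) ?_⟩
  · zify
    rw [← e₀]
    positivity
  · zify
    rwa [← e₁]
  · zify
    rw [← e₂]
    positivity
  · zify
    rw [← e₁, ← e₂]
    linarith
  · have hcop : Nat.Coprime (a₀ + a₂) (a₀ + a₁ + a₂) := by
      rw [← Nat.isCoprime_iff_coprime, x₁, y₁]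
      exact (isCoprime_doubled_hypotenuse h hab hc).pow
    have g₀ := Nat.gcd_dvd_left a₀ (Nat.gcd a₁ a₂)
    have g := Nat.gcd_dvd_right a₀ (Nat.gcd a₁ a₂)
    have g₁ := g.trans (Nat.gcd_dvd_left a₁ a₂)
    have g₂ := g.trans (Nat.gcd_dvd_right a₁ a₂)
    exact Nat.eq_one_of_dvd_coprimes hcop (dvd_add g₀ g₂) (dvd_add (dvd_add g₀ g₁) g₂)
  · push_cast at y₁ ⊢
    have : (a₀ + a₁ : ℤ) = (c ^ 4 + 4 * a ^ 2 * b ^ 2) ^ 2 -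
        8 * a * b * (c * (a ^ 2 - b ^ 2)) ^ 2 := by rw [e₂]; linarith
    rw [this]
    linear_combination (c ^ 4 + 4 * a ^ 2 * b ^ 2 + (a ^ 2 - b ^ 2) ^ 2 + 8 * a ^ 2 * b ^ 2) * hy
      - 16 * a ^ 2 * b ^ 2 * hcc
  · push_cast
    rw [← e₀, ← e₂]
    ring
  · push_cast at y₁ ⊢
    have : (a₀ + a₁ + 2 * a₂ : ℤ) = (c ^ 4 + 4 * a ^ 2 * b ^ 2) ^ 2 +
        8 * a * b * (c * (a ^ 2 - b ^ 2)) ^ 2 := by rw [e₂]; linarith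
    rw [this]
    linear_combination (c ^ 4 + 4 * a ^ 2 * b ^ 2 + (a ^ 2 - b ^ 2) ^ 2 + 8 * a ^ 2 * b ^ 2) * hy
      - 16 * a ^ 2 * b ^ 2 * hcc

theorem isCoprime_legs (n : ℤ) :
    IsCoprime ((6 * n + 1) * (4 * n + 1)) (2 * n * (5 * n + 1)) := by
  refine IsCoprime.mul_left (IsCoprime.mul_right ?_ ?_) (IsCoprime.mul_right ?_ ?_)
  · exact ⟨1, -3, by ring⟩
  · exact ⟨-5, 6, by ring⟩
  · exact ⟨1, -2, by ring⟩
  · exact ⟨5, -4, by ring⟩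

theorem stmt7 :
    {q : ℕ × ℕ × ℕ |
      0 < q.1 ∧ 0 < q.2.1 ∧ 0 < q.2.2 ∧ q.2.1 < q.2.2 ∧
      Nat.gcd q.1 (Nat.gcd q.2.1 q.2.2) = 1 ∧
      IsSquare q.1 ∧ IsSquare (q.1 + q.2.1) ∧ IsSquare (q.1 + q.2.2) ∧
      IsSquare (q.1 + q.2.1 + q.2.2) ∧ IsSquare (q.1 + 2 * q.2.2) ∧
      IsSquare (q.1 + q.2.1 + 2 * q.2.2)}.Infinite := by
  refine Set.Infinite.of_image Prod.fst (Set.infinite_of_forall_exists_gt fun N => ?_)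
  obtain ⟨n, hn⟩ : ∃ n : ℤ, n = N + 10 := ⟨_, rfl⟩
  obtain ⟨a₀, a₁, a₂, h₀, h⟩ := exists_reduced_cube_of_pythagorean
    (a := (6 * n + 1) * (4 * n + 1)) (b := 2 * n * (5 * n + 1)) (c := 26 * n ^ 2 + 10 * n + 1)
    (by ring) (isCoprime_legs n) ⟨13 * n ^ 2 + 5 * n, by ring⟩ (by subst hn; positivity)
    (by subst hn; rw [← sub_pos]; ring_nf; positivity) (by subst hn; positivity)
    (by subst hn; rw [← sub_pos]; ring_nf; positivity)
    (by subst hn; rw [← sub_pos]; ring_nf; positivity)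
  refine ⟨a₀, ⟨(a₀, a₁, a₂), h, rfl⟩, ?_⟩
  zify
  rw [h₀, hn, ← sub_pos]
  ring_nf
  positivity
end

section
/- Let H₂(N) denote the number of triples (a₀, a₁, a₂) of nonnegative integers with a₀, a₁, a₂ ≤ N such that all four numbers a₀, a₀ + a₁, a₀ + a₂, a₀ + a₁ + a₂ are perfect squares. Then there exist constants c₁, c₂ > 0 and a threshold N₀ such that for all N ≥ N₀, c₁ · N · log N ≤ H₂(N) ≤ c₂ · N · log N. -/
theorem sum_Icc_inv_sq_le_two (X : ℕ) : ∑ e ∈ Finset.Icc 1 X, 1 / (e : ℝ) ^ 2 ≤ 2 := by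
  have key : ∀ n : ℕ, ∑ e ∈ Finset.Icc 1 (n + 1), 1 / (e : ℝ) ^ 2 ≤ 2 - 1 / ((n : ℝ) + 1) := by
    intro n
    induction n with
    | zero => norm_num
    | succ k ih =>
      rw [Finset.sum_Icc_succ_top (by omega)]
      have h : 1 / (((k + 1 + 1 : ℕ) : ℝ)) ^ 2 ≤ 1 / ((k : ℝ) + 1) - 1 / ((k : ℝ) + 1 + 1) := by
        push_cast
        rw [div_sub_div _ _ (by positivity) (by positivity),
          div_le_div_iff₀ (by positivity) (by positivity)]
        nlinarith [(Nat.cast_nonneg k : (0 : ℝ) ≤ k)]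
      push_cast at h ih ⊢
      linarith
  rcases X with _ | n
  · norm_num
  · have h := key n
    have : (0 : ℝ) ≤ 1 / ((n : ℝ) + 1) := by positivity
    linarith

theorem sum_Icc_inv_le_two_mul_sum_totient_div_sq (X : ℕ) :
    ∑ n ∈ Finset.Icc 1 X, 1 / (n : ℝ) ≤
      2 * ∑ m ∈ Finset.Icc 1 X, (Nat.totient m : ℝ) / (m : ℝ) ^ 2 := by
  have hfib : ∀ n ∈ Finset.Icc 1 X, 1 / (n : ℝ) =
      ∑ q ∈ ((Finset.Icc 1 X ×ˢ Finset.Icc 1 X).filter (fun q : ℕ × ℕ => q.1 * q.2 ≤ X)).filter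
        (fun q => q.1 * q.2 = n), (Nat.totient q.1 : ℝ) / (q.1 : ℝ) ^ 2 * (1 / (q.2 : ℝ) ^ 2) := by
    intro n hn
    rw [Finset.mem_Icc] at hn
    have hset : ((Finset.Icc 1 X ×ˢ Finset.Icc 1 X).filter
        (fun q : ℕ × ℕ => q.1 * q.2 ≤ X)).filter (fun q => q.1 * q.2 = n) =
        n.divisorsAntidiagonal := by
      ext ⟨d, e⟩
      simp only [Finset.mem_filter, Finset.mem_product, Finset.mem_Icc,
        Nat.mem_divisorsAntidiagonal]
      constructor
      · rintro ⟨-, h⟩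
        exact ⟨h, by omega⟩
      · rintro ⟨h, -⟩
        have hd : 1 ≤ d := Nat.one_le_iff_ne_zero.2 (by rintro rfl; omega)
        have he : 1 ≤ e := Nat.one_le_iff_ne_zero.2 (by rintro rfl; omega)
        refine ⟨⟨⟨⟨hd, ?_⟩, he, ?_⟩, by omega⟩, h⟩ <;> nlinarith
    rw [hset]
    have hn0 : (n : ℝ) ≠ 0 := by
      have : n ≠ 0 := by omega
      exact_mod_cast this
    have hterm : ∀ q ∈ n.divisorsAntidiagonal,
        (Nat.totient q.1 : ℝ) / (q.1 : ℝ) ^ 2 * (1 / (q.2 : ℝ) ^ 2) =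
          (Nat.totient q.1 : ℝ) / (n : ℝ) ^ 2 := by
      intro q hq
      rw [← (Nat.mem_divisorsAntidiagonal.1 hq).1]
      push_cast
      rw [mul_pow, div_mul_div_comm, mul_one]
    rw [Finset.sum_congr rfl hterm, ← Finset.sum_div,
      Nat.sum_divisorsAntidiagonal (fun i _ => (Nat.totient i : ℝ))]
    rw [← Nat.cast_sum, Nat.sum_totient]
    field_simp
  rw [Finset.sum_congr rfl hfib, Finset.sum_fiberwise_of_maps_to]
  · calc _ ≤ ∑ q ∈ Finset.Icc 1 X ×ˢ Finset.Icc 1 X,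
          (Nat.totient q.1 : ℝ) / (q.1 : ℝ) ^ 2 * (1 / (q.2 : ℝ) ^ 2) :=
          Finset.sum_le_sum_of_subset_of_nonneg (Finset.filter_subset _ _)
            (fun _ _ _ => by positivity)
      _ = (∑ m ∈ Finset.Icc 1 X, (Nat.totient m : ℝ) / (m : ℝ) ^ 2) *
          ∑ e ∈ Finset.Icc 1 X, 1 / (e : ℝ) ^ 2 := by
          rw [Finset.sum_mul_sum, Finset.sum_product]
      _ ≤ _ := by
          rw [mul_comm (2 : ℝ)]
          exact mul_le_mul_of_nonneg_left (sum_Icc_inv_sq_le_two X)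
            (Finset.sum_nonneg fun _ _ => by positivity)
  · intro q hq
    simp only [Finset.mem_filter, Finset.mem_product, Finset.mem_Icc] at hq ⊢
    exact ⟨Nat.mul_pos hq.1.1.1 hq.1.2.1, hq.2⟩

/-- The triples `(a₀, a₁, a₂)` with entries at most `N` whose Hilbert square consists of squares. -/
def squareCubes (N : ℕ) : Set (ℕ × ℕ × ℕ) :=
  {q : ℕ × ℕ × ℕ | q.1 ≤ N ∧ q.2.1 ≤ N ∧ q.2.2 ≤ N ∧
    IsSquare q.1 ∧ IsSquare (q.1 + q.2.1) ∧ IsSquare (q.1 + q.2.2) ∧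
    IsSquare (q.1 + q.2.1 + q.2.2)}

theorem squareCubes_finite (N : ℕ) : (squareCubes N).Finite := by
  refine (Finset.finite_toSet (Finset.Icc 0 N ×ˢ Finset.Icc 0 N ×ˢ Finset.Icc 0 N)).subset ?_
  rintro ⟨a, b, c⟩ ⟨h1, h2, h3, -⟩
  simpa using ⟨h1, h2, h3⟩

/-- The Hilbert square with vertices `(cd - ab)²`, `(cd + ab)²`, `(bd - ac)²`, `(bd + ac)²`. -/
def cubeOfParams (a b c d : ℕ) : ℕ × ℕ × ℕ :=
  ((c * d - a * b) ^ 2, 4 * a * b * c * d, (b * d - a * c) ^ 2 - (c * d - a * b) ^ 2)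

theorem exists_cubeOfParams_eq {a b c d : ℕ} (hcb : c ≤ b) (had : a ≤ d) (h : a * b ≤ c * d) :
    ∃ x z : ℕ, a * b + x = c * d ∧ a * c + z = b * d ∧ x ≤ z ∧
      cubeOfParams a b c d = (x ^ 2, 4 * a * b * c * d, z ^ 2 - x ^ 2) ∧
      x ^ 2 + 4 * a * b * c * d = (c * d + a * b) ^ 2 ∧
      z ^ 2 + 4 * a * b * c * d = (b * d + a * c) ^ 2 := by
  obtain ⟨x, hx⟩ := Nat.exists_eq_add_of_le h
  have h2 : a * c ≤ b * d := by nlinarith [Nat.mul_le_mul had hcb]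
  obtain ⟨z, hz⟩ := Nat.exists_eq_add_of_le h2
  refine ⟨x, z, hx.symm, hz.symm, ?_, ?_, ?_, ?_⟩
  · nlinarith
  · simp [cubeOfParams, hx, hz]
  · have : 4 * a * b * c * d = 4 * (a * b) * (c * d) := by ring
    rw [this, hx]; ring
  · have : 4 * a * b * c * d = 4 * (a * c) * (b * d) := by ring
    rw [this, hz]; ring

theorem cubeOfParams_mem {a b c d N : ℕ} (hcb : c ≤ b) (had : a ≤ d) (h : a * b ≤ c * d)
    (h1 : (c * d + a * b) ^ 2 ≤ N) (h2 : (b * d) ^ 2 ≤ N) :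
    cubeOfParams a b c d ∈ squareCubes N := by
  obtain ⟨x, z, hx, hz, hxz, he, hy, hw⟩ := exists_cubeOfParams_eq hcb had h
  have hxz2 : x ^ 2 ≤ z ^ 2 := Nat.pow_le_pow_left hxz 2
  have hzN : z ^ 2 ≤ N := (Nat.pow_le_pow_left (by omega) 2).trans h2
  rw [he]
  refine ⟨by dsimp; omega, by dsimp; omega, by dsimp; omega, ⟨x, by dsimp; ring⟩,
    ⟨c * d + a * b, ?_⟩, ⟨z, ?_⟩, ⟨b * d + a * c, ?_⟩⟩
  · dsimp; rw [hy]; ring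
  · dsimp; rw [Nat.add_sub_cancel' hxz2]; ring
  · dsimp; rw [← sq, ← hw]; omega

theorem cubeOfParams_inj {a b c d a' b' c' d' : ℕ} (ha : 0 < a) (hc : 0 < c)
    (hcb : c ≤ b) (had : a ≤ d) (h : a * b ≤ c * d) (hco : Nat.Coprime b c)
    (hcb' : c' ≤ b') (had' : a' ≤ d') (h' : a' * b' ≤ c' * d') (hco' : Nat.Coprime b' c')
    (heq : cubeOfParams a b c d = cubeOfParams a' b' c' d') :
    a = a' ∧ b = b' ∧ c = c' ∧ d = d' := by
  obtain ⟨x, z, hx, hz, hxz, he, hy, hw⟩ := exists_cubeOfParams_eq hcb had h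
  obtain ⟨x', z', hx', hz', hxz', he', hy', hw'⟩ := exists_cubeOfParams_eq hcb' had' h'
  rw [he, he'] at heq
  simp only [Prod.mk.injEq] at heq
  obtain ⟨e1, e2, e3⟩ := heq
  have hxz2 : x ^ 2 ≤ z ^ 2 := Nat.pow_le_pow_left hxz 2
  have hxz2' : x' ^ 2 ≤ z' ^ 2 := Nat.pow_le_pow_left hxz' 2
  have sq_inj : ∀ u v : ℕ, u ^ 2 = v ^ 2 → u = v := fun u v huv =>
    Nat.pow_left_injective (by norm_num) huv
  have ex := sq_inj _ _ e1
  have ez : z = z' := sq_inj _ _ (by omega)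
  have ey := sq_inj _ _ (hy.symm.trans ((by rw [e1, e2] : _ = _).trans hy'))
  have ew := sq_inj _ _ (hw.symm.trans ((by rw [ez, e2] : _ = _).trans hw'))
  have p1 : a * b = a' * b' := by omega
  have p2 : c * d = c' * d' := by omega
  have p3 : a * c = a' * c' := by omega
  have eaa : a = a' := by
    have g1 : Nat.gcd (a * b) (a * c) = a := by rw [Nat.gcd_mul_left, hco.gcd_eq_one, mul_one]
    have g2 : Nat.gcd (a' * b') (a' * c') = a' := by
      rw [Nat.gcd_mul_left, hco'.gcd_eq_one, mul_one]
    rw [← g1, ← g2, p1, p3]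
  subst eaa
  have eb := Nat.eq_of_mul_eq_mul_left ha p1
  have ec := Nat.eq_of_mul_eq_mul_left ha p3
  subst ec
  exact ⟨rfl, eb, rfl, Nat.eq_of_mul_eq_mul_left hc p2⟩

theorem sum_totient_mul_sq_le_ncard (M N : ℕ) (hM : M ^ 2 ≤ N) :
    ∑ m ∈ Finset.Icc 1 (M / 6), Nat.totient m * (M / (6 * m)) ^ 2 ≤ (squareCubes N).ncard := by
  let s : Finset (Σ _ : ℕ, ℕ × ℕ × ℕ) := (Finset.Icc 1 (M / 6)).sigma fun m =>
    ((Finset.range m).filter (Nat.Coprime m)) ×ˢ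
      (Finset.Icc 1 (M / (6 * m)) ×ˢ Finset.Icc 1 (M / (6 * m)))
  let f : (Σ _ : ℕ, ℕ × ℕ × ℕ) → ℕ × ℕ × ℕ := fun t =>
    cubeOfParams t.2.2.1 (t.1 + t.2.1) t.1 (2 * (M / (6 * t.1)) + t.2.2.2)
  have hs : s.card = ∑ m ∈ Finset.Icc 1 (M / 6), Nat.totient m * (M / (6 * m)) ^ 2 := by
    simp only [s, Finset.card_sigma, Finset.card_product, Nat.card_Icc, Nat.totient]
    refine Finset.sum_congr rfl fun m _ => ?_
    rw [Nat.add_sub_cancel, sq]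
  have hmem : ∀ t ∈ s, 1 ≤ t.1 ∧ t.2.1 < t.1 ∧ Nat.Coprime t.1 t.2.1 ∧ 1 ≤ t.2.2.1 ∧
      t.2.2.1 ≤ M / (6 * t.1) ∧ 1 ≤ t.2.2.2 ∧ t.2.2.2 ≤ M / (6 * t.1) := by
    intro t ht
    simp only [s, Finset.mem_sigma, Finset.mem_product, Finset.mem_filter, Finset.mem_Icc,
      Finset.mem_range] at ht
    tauto
  have hord : ∀ m n a e K : ℕ, n < m → a ≤ K →
      a * (m + n) ≤ m * (2 * K + e) := by
    intro m n a e K h1 h2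
    calc a * (m + n) ≤ K * (m + m) := Nat.mul_le_mul h2 (by omega)
      _ ≤ m * (2 * K + e) := by nlinarith [Nat.zero_le (m * e)]
  rw [← hs, ← Set.ncard_coe_finset]
  refine Set.ncard_le_ncard_of_injOn f ?_ ?_ (squareCubes_finite N)
  · intro t ht
    obtain ⟨h1, h2, h3, h4, h5, h6, h7⟩ := hmem t ht
    obtain ⟨m, n, a, e⟩ := t
    dsimp only at h1 h2 h3 h4 h5 h6 h7
    have hK : M / (6 * m) * (6 * m) ≤ M := Nat.div_mul_le_self _ _
    dsimp only [f]
    generalize M / (6 * m) = K at *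
    refine cubeOfParams_mem (by omega) (by omega) (hord m n a e K h2 h5) ?_ ?_
    · refine (Nat.pow_le_pow_left ?_ 2).trans hM
      calc m * (2 * K + e) + a * (m + n) ≤ m * (2 * K + K) + K * (m + m) := by gcongr
        _ ≤ M := by nlinarith
    · refine (Nat.pow_le_pow_left ?_ 2).trans hM
      calc (m + n) * (2 * K + e) ≤ (m + m) * (2 * K + K) := by gcongr
        _ ≤ M := by nlinarith
  · intro t ht t' ht' heq
    obtain ⟨h1, h2, h3, h4, h5, h6, h7⟩ := hmem t ht
    obtain ⟨h1', h2', h3', h4', h5', h6', h7'⟩ := hmem t' ht'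
    obtain ⟨m, n, a, e⟩ := t
    obtain ⟨m', n', a', e'⟩ := t'
    dsimp only [f] at *
    obtain ⟨r1, r2, r3, r4⟩ := cubeOfParams_inj (by omega) (by omega) (by omega) (by omega)
      (hord m n a e _ h2 h5) (by simpa using h3.symm) (by omega) (by omega)
      (hord m' n' a' e' _ h2' h5') (by simpa using h3'.symm) heq
    subst r1 r3
    obtain rfl : n = n' := by omega
    obtain rfl : e = e' := by omega
    rfl

theorem exists_eq_mul_of_mul_eq_mul {p q r s : ℕ} (hp : 0 < p) (h : p * q = r * s) :
    ∃ a b c d : ℕ, p = a * b ∧ q = c * d ∧ r = a * c ∧ s = b * d := by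
  obtain ⟨b, c, hbc, hb, hc⟩ := Nat.exists_coprime p r
  have hg : 0 < Nat.gcd p r := Nat.gcd_pos_of_pos_left _ hp
  set g := Nat.gcd p r
  have hb0 : 0 < b := Nat.pos_of_ne_zero (by rintro rfl; omega)
  have h1 : b * q = c * s := by
    apply Nat.eq_of_mul_eq_mul_left hg
    rw [← mul_assoc, ← mul_assoc, mul_comm g b, mul_comm g c, ← hb, ← hc, h]
  obtain ⟨d, hd⟩ := hbc.dvd_of_dvd_mul_left (Dvd.intro q h1)
  refine ⟨g, b, c, d, by rw [mul_comm, ← hb], ?_, by rw [mul_comm, ← hc], hd⟩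
  apply Nat.eq_of_mul_eq_mul_left hb0
  rw [h1, hd]; ring

/-- The Hilbert square attached to a solution of `p q = r s`. -/
def cubeOfFactors (p q r s : ℕ) : ℕ × ℕ × ℕ :=
  (((q - p) / 2) ^ 2, ((q + p) / 2) ^ 2 - ((q - p) / 2) ^ 2,
    ((s - r) / 2) ^ 2 - ((q - p) / 2) ^ 2)

theorem exists_factors_of_mem_squareCubes {N L : ℕ} (hL : ∀ y, y ^ 2 ≤ 12 * N → y ≤ L)
    {t : ℕ × ℕ × ℕ} (ht : t ∈ squareCubes N) (h0 : t.2.1 ≠ 0) :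
    ∃ p q r s : ℕ, 0 < p ∧ 0 < q ∧ 0 < r ∧ 0 < s ∧ p ≤ L ∧ q ≤ L ∧ r ≤ L ∧ s ≤ L ∧
      p * q = r * s ∧ cubeOfFactors p q r s = t := by
  obtain ⟨a₀, a₁, a₂⟩ := t
  obtain ⟨h1, h2, h3, ⟨x, hx⟩, ⟨y, hy⟩, ⟨z, hz⟩, ⟨w, hw⟩⟩ := ht
  dsimp only at *
  have hxy : x < y := by
    by_contra! hc
    have := Nat.mul_le_mul hc hc
    omega
  have hzw : z < w := by
    by_contra! hc
    have := Nat.mul_le_mul hc hc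
    omega
  obtain ⟨p, rfl⟩ := Nat.exists_eq_add_of_le hxy.le
  obtain ⟨r, rfl⟩ := Nat.exists_eq_add_of_le hzw.le
  refine ⟨p, 2 * x + p, r, 2 * z + r, by omega, by omega, by omega, by omega, hL _ ?_, hL _ ?_,
    hL _ ?_, hL _ ?_, by nlinarith, ?_⟩
  · nlinarith
  · nlinarith
  · nlinarith
  · nlinarith
  · have e1 : (2 * x + p - p) / 2 = x := by omega
    have e2 : (2 * x + p + p) / 2 = x + p := by omega
    have e3 : (2 * z + r - r) / 2 = z := by omega
    simp only [cubeOfFactors, e1, e2, e3, sq]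
    simp only [Prod.mk.injEq]
    omega

theorem ncard_squareCubes_le (N L : ℕ) (hL : ∀ y, y ^ 2 ≤ 12 * N → y ≤ L) :
    (squareCubes N).ncard ≤
      2 * ∑ b ∈ Finset.Icc 1 L, (L / b) * (b * (L / b)) + (L + 1) * (L + 1) := by
  let s : Finset (Σ _ : ℕ, ℕ × ℕ × ℕ) := (Finset.Icc 1 L).sigma fun b =>
    Finset.Icc 1 (L / b) ×ˢ (Finset.Icc 1 b ×ˢ Finset.Icc 1 (L / b))
  let f₁ : (Σ _ : ℕ, ℕ × ℕ × ℕ) → ℕ × ℕ × ℕ := fun t =>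
    cubeOfFactors (t.2.1 * t.1) (t.2.2.1 * t.2.2.2) (t.2.1 * t.2.2.1) (t.1 * t.2.2.2)
  let f₂ : (Σ _ : ℕ, ℕ × ℕ × ℕ) → ℕ × ℕ × ℕ := fun t =>
    cubeOfFactors (t.2.1 * t.2.2.1) (t.1 * t.2.2.2) (t.2.1 * t.1) (t.2.2.1 * t.2.2.2)
  let u : Finset (ℕ × ℕ) := Finset.range (L + 1) ×ˢ Finset.range (L + 1)
  let g : ℕ × ℕ → ℕ × ℕ × ℕ := fun v => (v.1 ^ 2, 0, v.2 ^ 2 - v.1 ^ 2)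
  have hs : s.card = ∑ b ∈ Finset.Icc 1 L, (L / b) * (b * (L / b)) := by
    simp [s, Finset.card_sigma, Finset.card_product]
  have hu : u.card = (L + 1) * (L + 1) := by simp [u]
  have hmem : ∀ a b c d : ℕ, 0 < a → 0 < b → 0 < c → 0 < d → c ≤ b → a * b ≤ L → b * d ≤ L →
      (⟨b, a, c, d⟩ : Σ _ : ℕ, ℕ × ℕ × ℕ) ∈ s := by
    intro a b c d ha hb hc hd hcb h1 h2
    have hbL : b ≤ L := by nlinarith
    have haL : a ≤ L / b := (Nat.le_div_iff_mul_le hb).2 h1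
    have hdL : d ≤ L / b := (Nat.le_div_iff_mul_le hb).2 (by rwa [mul_comm])
    simp only [s, Finset.mem_sigma, Finset.mem_product, Finset.mem_Icc]
    exact ⟨⟨hb, hbL⟩, ⟨ha, haL⟩, ⟨hc, hcb⟩, hd, hdL⟩
  have hsub : squareCubes N ⊆ ((s.image f₁ ∪ s.image f₂ ∪ u.image g : Finset _) : Set _) := by
    intro t ht
    rw [Finset.mem_coe, Finset.mem_union, Finset.mem_union]
    by_cases h0 : t.2.1 = 0
    · right
      obtain ⟨a₀, a₁, a₂⟩ := t
      obtain ⟨h1, h2, h3, ⟨x, hx⟩, -, ⟨z, hz⟩, -⟩ := ht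
      dsimp only at *
      refine Finset.mem_image.2 ⟨(x, z), ?_, ?_⟩
      · have hxL := hL x (by nlinarith)
        have hzL := hL z (by nlinarith)
        simp only [u, Finset.mem_product, Finset.mem_range]
        omega
      · simp only [g, sq, Prod.mk.injEq]
        omega
    · left
      obtain ⟨p, q, r, v, hp, hq, hr, hv, hpL, hqL, hrL, hvL, hmul, he⟩ :=
        exists_factors_of_mem_squareCubes hL ht h0
      obtain ⟨a, b, c, d, rfl, rfl, rfl, rfl⟩ := exists_eq_mul_of_mul_eq_mul hp hmul
      have ha := Nat.pos_of_mul_pos_right hp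
      have hb := Nat.pos_of_mul_pos_left hp
      have hc := Nat.pos_of_mul_pos_right hq
      have hd := Nat.pos_of_mul_pos_left hq
      rcases le_total c b with hcb | hcb
      · left
        exact Finset.mem_image.2 ⟨⟨b, a, c, d⟩, hmem a b c d ha hb hc hd hcb hpL hvL, he⟩
      · right
        exact Finset.mem_image.2 ⟨⟨c, a, b, d⟩, hmem a c b d ha hc hb hd hcb hrL hqL, he⟩
  calc (squareCubes N).ncard ≤ (s.image f₁ ∪ s.image f₂ ∪ u.image g).card := by
        rw [← Set.ncard_coe_finset]
        exact Set.ncard_le_ncard hsub (Finset.finite_toSet _)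
    _ ≤ (s.card + s.card) + u.card :=
        (Finset.card_union_le _ _).trans (add_le_add ((Finset.card_union_le _ _).trans
          (add_le_add Finset.card_image_le Finset.card_image_le)) Finset.card_image_le)
    _ = _ := by rw [hs, hu]; ring

theorem sum_Icc_inv_eq_harmonic (n : ℕ) :
    ∑ i ∈ Finset.Icc 1 n, 1 / (i : ℝ) = (harmonic n : ℝ) := by
  rw [harmonic_eq_sum_Icc]
  push_cast
  simp only [one_div]

theorem ncard_squareCubes_le_mul_log {N : ℕ} (hN : 20736 ≤ N) :
    ((squareCubes N).ncard : ℝ) ≤ 120 * (N : ℝ) * Real.log N := by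
  have hNR : (20736 : ℝ) ≤ N := by exact_mod_cast hN
  set L := Nat.sqrt (12 * N) with hLdef
  have hL : ∀ y, y ^ 2 ≤ 12 * N → y ≤ L := fun y hy => Nat.le_sqrt'.2 hy
  have hL1 : 1 ≤ L := hL 1 (by omega)
  have hL1R : (1 : ℝ) ≤ L := by exact_mod_cast hL1
  have hL2 : (L : ℝ) ^ 2 ≤ 12 * N := by exact_mod_cast Nat.sqrt_le' (12 * N)
  have h1 : ((squareCubes N).ncard : ℝ) ≤
      2 * ∑ b ∈ Finset.Icc 1 L, ((L / b : ℕ) : ℝ) * (b * ((L / b : ℕ) : ℝ)) +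
        ((L : ℝ) + 1) * (L + 1) := by
    exact_mod_cast ncard_squareCubes_le N L hL
  have h2 : ∑ b ∈ Finset.Icc 1 L, ((L / b : ℕ) : ℝ) * (b * ((L / b : ℕ) : ℝ)) ≤
      (L : ℝ) ^ 2 * (1 + Real.log L) := by
    calc _ ≤ ∑ b ∈ Finset.Icc 1 L, (L : ℝ) ^ 2 * (1 / (b : ℝ)) := by
          refine Finset.sum_le_sum fun b hb => ?_
          have hb0 : (0 : ℝ) < b := by exact_mod_cast (Finset.mem_Icc.1 hb).1
          have hd : ((L / b : ℕ) : ℝ) ≤ (L : ℝ) / b := Nat.cast_div_le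
          calc _ ≤ (L : ℝ) / b * (b * ((L : ℝ) / b)) := by gcongr
            _ = _ := by field_simp
      _ = (L : ℝ) ^ 2 * (harmonic L : ℝ) := by
          rw [← Finset.mul_sum, sum_Icc_inv_eq_harmonic]
      _ ≤ _ := by gcongr; exact harmonic_le_one_add_log L
  have hlogN : 1 ≤ Real.log N := by
    rw [Real.le_log_iff_exp_le (by linarith)]
    linarith [Real.exp_one_lt_d9]
  have hlogL : Real.log L ≤ Real.log N := by
    apply Real.log_le_log (by linarith)
    nlinarith
  have hlogL0 : 0 ≤ Real.log L := Real.log_nonneg hL1R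
  have h3 : (L : ℝ) ^ 2 * (1 + Real.log L) ≤ (12 * N) * (2 * Real.log N) := by
    gcongr; linarith
  have h4 : ((L : ℝ) + 1) * (L + 1) ≤ 48 * N := by nlinarith
  have h5 : 48 * (N : ℝ) ≤ 48 * N * Real.log N := le_mul_of_one_le_right (by positivity) hlogN
  nlinarith

theorem mul_log_le_ncard_squareCubes {N : ℕ} (hN : 20736 ≤ N) :
    1 / 4608 * (N : ℝ) * Real.log N ≤ ((squareCubes N).ncard : ℝ) := by
  have hNR : (20736 : ℝ) ≤ N := by exact_mod_cast hN
  set M := Nat.sqrt N with hMdef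
  have hM1 : 144 ≤ M := Nat.le_sqrt'.2 (by omega)
  have hM1R : (144 : ℝ) ≤ M := by exact_mod_cast hM1
  have hM3 : (N : ℝ) ≤ 4 * (M : ℝ) ^ 2 := by
    have : (N : ℝ) < ((M : ℝ) + 1) ^ 2 := by exact_mod_cast Nat.lt_succ_sqrt' N
    nlinarith
  have h1 : ∑ m ∈ Finset.Icc 1 (M / 6), (Nat.totient m : ℝ) * ((M / (6 * m) : ℕ) : ℝ) ^ 2 ≤
      ((squareCubes N).ncard : ℝ) := by
    exact_mod_cast sum_totient_mul_sq_le_ncard M N (Nat.sqrt_le' N)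
  have h2 : (M : ℝ) ^ 2 / 144 * ∑ m ∈ Finset.Icc 1 (M / 6), (Nat.totient m : ℝ) / (m : ℝ) ^ 2 ≤
      ∑ m ∈ Finset.Icc 1 (M / 6), (Nat.totient m : ℝ) * ((M / (6 * m) : ℕ) : ℝ) ^ 2 := by
    rw [Finset.mul_sum]
    refine Finset.sum_le_sum fun m hm => ?_
    rw [Finset.mem_Icc] at hm
    have hm0 : (0 : ℝ) < m := by exact_mod_cast hm.1
    have hK : (M : ℝ) / (12 * m) ≤ ((M / (6 * m) : ℕ) : ℝ) := by
      rw [div_le_iff₀ (by positivity)]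
      have hlt : M < 6 * m * (M / (6 * m) + 1) := Nat.lt_mul_div_succ M (by omega)
      have hpos : 1 ≤ M / (6 * m) := (Nat.one_le_div_iff (by omega)).2 (by omega)
      have : M ≤ M / (6 * m) * (12 * m) := by nlinarith
      exact_mod_cast this
    calc (M : ℝ) ^ 2 / 144 * ((Nat.totient m : ℝ) / (m : ℝ) ^ 2)
        = (Nat.totient m : ℝ) * ((M : ℝ) / (12 * m)) ^ 2 := by field_simp; ring
      _ ≤ _ := by gcongr
  have h3 := sum_Icc_inv_le_two_mul_sum_totient_div_sq (M / 6)
  rw [sum_Icc_inv_eq_harmonic] at h3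
  have h4 : Real.log ((M : ℝ) / 6) ≤ (harmonic (M / 6) : ℝ) := by
    refine le_trans (Real.log_le_log (by positivity) ?_) (log_add_one_le_harmonic (M / 6))
    have : M ≤ 6 * (M / 6 + 1) := by omega
    rw [div_le_iff₀ (by norm_num), mul_comm]
    exact_mod_cast this
  have h5 : Real.log N ≤ 4 * Real.log ((M : ℝ) / 6) := by
    have : (4 : ℝ) * Real.log ((M : ℝ) / 6) = Real.log (((M : ℝ) / 6) ^ 4) := by
      rw [Real.log_pow]; norm_num
    rw [this]
    apply Real.log_le_log (by linarith)
    have hsq : (20736 : ℝ) ≤ (M : ℝ) ^ 2 := by nlinarith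
    have : (M : ℝ) ^ 2 * 20736 ≤ (M : ℝ) ^ 2 * (M : ℝ) ^ 2 := by gcongr
    calc (N : ℝ) ≤ 4 * (M : ℝ) ^ 2 := hM3
      _ ≤ ((M : ℝ) / 6) ^ 4 := by nlinarith
  have hlogN : 0 ≤ Real.log N := Real.log_nonneg (by linarith)
  calc 1 / 4608 * (N : ℝ) * Real.log N
      ≤ 1 / 4608 * (4 * (M : ℝ) ^ 2) * Real.log N := by gcongr
    _ = (M : ℝ) ^ 2 / 144 * (Real.log N / 8) := by ring
    _ ≤ (M : ℝ) ^ 2 / 144 *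
        ∑ m ∈ Finset.Icc 1 (M / 6), (Nat.totient m : ℝ) / (m : ℝ) ^ 2 := by
        gcongr; linarith
    _ ≤ _ := h2.trans h1

theorem stmt8 :
    ∃ c₁ c₂ : ℝ, 0 < c₁ ∧ 0 < c₂ ∧ ∃ N₀ : ℕ, ∀ N : ℕ, N₀ ≤ N →
      c₁ * (N : ℝ) * Real.log N ≤
        ({q : ℕ × ℕ × ℕ | q.1 ≤ N ∧ q.2.1 ≤ N ∧ q.2.2 ≤ N ∧
          IsSquare q.1 ∧ IsSquare (q.1 + q.2.1) ∧ IsSquare (q.1 + q.2.2) ∧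
          IsSquare (q.1 + q.2.1 + q.2.2)}.ncard : ℝ) ∧
      (({q : ℕ × ℕ × ℕ | q.1 ≤ N ∧ q.2.1 ≤ N ∧ q.2.2 ≤ N ∧
          IsSquare q.1 ∧ IsSquare (q.1 + q.2.1) ∧ IsSquare (q.1 + q.2.2) ∧
          IsSquare (q.1 + q.2.1 + q.2.2)}.ncard : ℝ)) ≤ c₂ * (N : ℝ) * Real.log N := by
  exact ⟨1 / 4608, 120, by norm_num, by norm_num, 20736, fun N hN =>
    ⟨mul_log_le_ncard_squareCubes hN, ncard_squareCubes_le_mul_log hN⟩⟩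
end

section
/- Let d ≥ 2 be an integer and let H_d(N) denote the number of tuples (a₀, a₁, …, a_d) of nonnegative integers with aᵢ ≤ N for all i such that every sum a₀ + Σ_{i=1}^{d} εᵢaᵢ (εᵢ ∈ {0,1}) is a perfect square. Then for every ε > 0 there exists a constant C = C(d, ε) such that H_d(N) ≤ C · N^{1+ε} for all N ≥ 1. -/
theorem exists_card_divisors_le_mul_rpow (δ : ℝ) (hδ : 0 < δ) :
    ∃ C : ℝ, 0 < C ∧ ∀ n : ℕ, n ≠ 0 → (n.divisors.card : ℝ) ≤ C * (n : ℝ) ^ δ := by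
  set t : ℝ := (2 : ℝ) ^ δ - 1 with ht
  have ht0 : 0 < t := by
    have := Real.one_lt_rpow (x := 2) (by norm_num) hδ
    linarith
  set M : ℝ := 1 + 1 / t with hM
  have hM1 : 1 ≤ M := by
    have : 0 < 1 / t := by positivity
    linarith
  set B : ℕ := ⌈(2 : ℝ) ^ (1 / δ)⌉₊ with hB
  have local_bound (p a : ℕ) (hp : 2 ≤ p) :
      ((a : ℝ) + 1) ≤ (if p < B then M else 1) * ((p : ℝ) ^ δ) ^ a := by
    have hp' : (2 : ℝ) ≤ p := by exact_mod_cast hp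
    split_ifs with h
    · have h1 : (1 : ℝ) + a * t ≤ (1 + t) ^ a := one_add_mul_le_pow (by linarith) a
      have h2 : (1 + t) ^ a ≤ ((p : ℝ) ^ δ) ^ a := by
        apply pow_le_pow_left₀ (by linarith)
        have := Real.rpow_le_rpow (by norm_num) hp' hδ.le
        linarith
      calc (a : ℝ) + 1 ≤ M * (1 + a * t) := by
            have : M * (1 + a * t) = a + 1 + (a * t + 1 / t) := by
              rw [hM]; field_simp; ring
            have : 0 ≤ a * t + 1 / t := by positivity
            linarith
        _ ≤ M * ((p : ℝ) ^ δ) ^ a := by gcongr; exact h1.trans h2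
    · have h1 : (2 : ℝ) ≤ (p : ℝ) ^ δ := by
        have hBp : (2 : ℝ) ^ (1 / δ) ≤ p :=
          (Nat.le_ceil _).trans (by exact_mod_cast not_lt.mp h)
        have := Real.rpow_le_rpow (by positivity) hBp hδ.le
        rwa [← Real.rpow_mul (by norm_num), one_div_mul_cancel hδ.ne', Real.rpow_one] at this
      rw [one_mul]
      calc (a : ℝ) + 1 ≤ 2 ^ a := by exact_mod_cast Nat.lt_two_pow_self
        _ ≤ _ := pow_le_pow_left₀ (by norm_num) h1 a
  refine ⟨M ^ B, by positivity, fun n hn => ?_⟩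
  have hpow : (n : ℝ) ^ δ = ∏ p ∈ n.primeFactors, ((p : ℝ) ^ δ) ^ n.factorization p := by
    conv_lhs => rw [← Nat.prod_factorization_pow_eq_self hn]
    rw [Finsupp.prod, Nat.support_factorization]
    push_cast
    rw [← Real.finsetProd_rpow _ _ (fun _ _ => by positivity)]
    refine Finset.prod_congr rfl fun p _ => ?_
    rw [← Real.rpow_natCast, ← Real.rpow_natCast, ← Real.rpow_mul (by positivity),
      ← Real.rpow_mul (by positivity), mul_comm]
  rw [Nat.card_divisors hn, hpow]
  push_cast
  calc ∏ p ∈ n.primeFactors, ((n.factorization p : ℝ) + 1)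
      ≤ ∏ p ∈ n.primeFactors, ((if p < B then M else 1) * ((p : ℝ) ^ δ) ^ n.factorization p) :=
        Finset.prod_le_prod (fun _ _ => by positivity) fun p hp =>
          local_bound p _ (Nat.prime_of_mem_primeFactors hp).two_le
    _ = (∏ p ∈ n.primeFactors, if p < B then M else 1) *
          ∏ p ∈ n.primeFactors, ((p : ℝ) ^ δ) ^ n.factorization p := Finset.prod_mul_distrib
    _ ≤ _ := by
        gcongr
        rw [← Finset.prod_filter, Finset.prod_const]
        refine pow_le_pow_right₀ hM1 ?_
        calc _ ≤ (Finset.range B).card := Finset.card_le_card fun p hp => by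
              simpa using (Finset.mem_filter.mp hp).2
          _ = B := Finset.card_range B

/-- The possible values of `z ^ 2 - x ^ 2`, where `z ^ 2` and `z ^ 2 + D` are both squares,
together with `D` itself. -/
def squareShifts (x D : ℕ) : Finset ℕ :=
  insert D (D.divisors.image fun g => ((D / g - g) / 2) ^ 2 - x ^ 2)

theorem card_squareShifts_le (x D : ℕ) : (squareShifts x D).card ≤ D.divisors.card + 1 :=
  (Finset.card_insert_le _ _).trans (Nat.add_le_add_right Finset.card_image_le 1)

theorem mem_squareShifts {x D b z w : ℕ} (hD : D ≠ 0) (hz : x ^ 2 + b = z ^ 2)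
    (hw : z ^ 2 + D = w ^ 2) : b ∈ squareShifts x D := by
  have hzw : z < w := lt_of_pow_lt_pow_left₀ 2 (Nat.zero_le _) (by omega)
  obtain ⟨g, rfl⟩ := Nat.exists_eq_add_of_lt hzw
  have hDg : D = (g + 1) * (2 * z + (g + 1)) := by nlinarith
  refine Finset.mem_insert_of_mem (Finset.mem_image.mpr ⟨g + 1, ?_, ?_⟩)
  · exact Nat.mem_divisors.mpr ⟨⟨_, hDg⟩, hD⟩
  · rw [hDg, Nat.mul_div_cancel_left _ (Nat.succ_pos g), Nat.add_sub_cancel,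
      Nat.mul_div_cancel_left _ (by norm_num)]
    omega

/-- A finite set containing all Hilbert cubes of squares with base and elements at most `N`. -/
def squareCubeCover (d N : ℕ) : Finset (ℕ × (Fin d → ℕ)) :=
  ((Finset.range (N + 1)).image fun a => (a, 0)) ∪
    (((Finset.range (Nat.sqrt (2 * N) + 1)) ×ˢ (Finset.range (Nat.sqrt (2 * N) + 1))).filter
      fun p => p.2 ^ 2 - p.1 ^ 2 ≠ 0 ∧ p.2 ^ 2 - p.1 ^ 2 ≤ N).biUnion fun p =>
        (Fintype.piFinset fun _ => squareShifts p.1 (p.2 ^ 2 - p.1 ^ 2)).image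
          fun b => (p.1 ^ 2, b)

theorem mem_squareCubeCover {d N : ℕ} {q : ℕ × (Fin d → ℕ)} (h0 : q.1 ≤ N)
    (hN : ∀ i, q.2 i ≤ N)
    (hq : ∀ e : Fin d → Bool, IsSquare (q.1 + ∑ i, if e i then q.2 i else 0)) :
    q ∈ squareCubeCover d N := by
  obtain ⟨a, b⟩ := q
  dsimp only at h0 hN hq
  rw [squareCubeCover, Finset.mem_union]
  by_cases hb : b = 0
  · left
    subst hb
    exact Finset.mem_image_of_mem _ (Finset.mem_range.mpr (by omega))
  · right
    obtain ⟨j, hj⟩ : ∃ j, b j ≠ 0 := Function.ne_iff.mp hb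
    have single (i : Fin d) : IsSquare (a + b i) := by
      have := hq fun k => decide (k = i)
      simpa using this
    have pair (i : Fin d) (hi : i ≠ j) : IsSquare (a + b i + b j) := by
      have h := hq fun k => decide (k ∈ ({i, j} : Finset (Fin d)))
      simp only [decide_eq_true_eq, Finset.sum_ite_mem, Finset.univ_inter,
        Finset.sum_pair hi] at h
      rwa [← add_assoc] at h
    obtain ⟨x, hx⟩ : IsSquare a := by simpa using hq fun _ => false
    obtain ⟨y, hy⟩ := single j
    rw [← pow_two] at hx hy
    have hD : y ^ 2 - x ^ 2 = b j := by omega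
    have hjN := hN j
    refine Finset.mem_biUnion.mpr ⟨(x, y), ?_, ?_⟩
    · simp only [Finset.mem_filter, Finset.mem_product, Finset.mem_range, Nat.lt_succ_iff,
        Nat.le_sqrt']
      omega
    · refine Finset.mem_image.mpr ⟨b, Fintype.mem_piFinset.mpr fun i => ?_, by simp [hx]⟩
      dsimp only
      rw [hD]
      by_cases hi : i = j
      · exact hi ▸ Finset.mem_insert_self _ _
      · obtain ⟨z, hz⟩ := single i
        obtain ⟨w, hw⟩ := pair i hi
        rw [← pow_two] at hz hw
        exact mem_squareShifts (z := z) (w := w) hj (by omega) (by omega)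

theorem card_squareCubeCover_le {d N : ℕ} (hN : 1 ≤ N) {K : ℝ}
    (hτ : ∀ n : ℕ, n ≠ 0 → n ≤ N → (n.divisors.card : ℝ) + 1 ≤ K) :
    ((squareCubeCover d N).card : ℝ) ≤ 2 * N + 6 * N * K ^ d := by
  have hK : 0 ≤ K := le_trans (by positivity) (hτ 1 one_ne_zero hN)
  rw [squareCubeCover]
  refine (Nat.cast_le.mpr (Finset.card_union_le _ _)).trans ?_
  push_cast
  gcongr
  · refine (Nat.cast_le.mpr Finset.card_image_le).trans ?_
    rw [Finset.card_range]
    exact_mod_cast (by omega : N + 1 ≤ 2 * N)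
  · refine (Nat.cast_le.mpr Finset.card_biUnion_le).trans ?_
    push_cast
    refine (Finset.sum_le_card_nsmul _ _ (K ^ d) fun p hp => ?_).trans ?_
    · obtain ⟨-, hp0, hpN⟩ := Finset.mem_filter.mp hp
      refine (Nat.cast_le.mpr Finset.card_image_le).trans ?_
      rw [Fintype.card_piFinset_const]
      push_cast
      refine pow_le_pow_left₀ (by positivity) (le_trans ?_ (hτ _ hp0 hpN)) d
      exact_mod_cast card_squareShifts_le _ _
    · rw [nsmul_eq_mul]
      gcongr
      refine (Nat.cast_le.mpr (Finset.card_filter_le _ _)).trans ?_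
      rw [Finset.card_product, Finset.card_range]
      have hs := Nat.sqrt_le (2 * N)
      exact_mod_cast (by nlinarith [Nat.le_self_pow two_ne_zero (Nat.sqrt (2 * N))] :
        (Nat.sqrt (2 * N) + 1) * (Nat.sqrt (2 * N) + 1) ≤ 6 * N)

theorem stmt9 (d : ℕ) (hd : 2 ≤ d) (ε : ℝ) (hε : 0 < ε) :
    ∃ C : ℝ, ∀ N : ℕ, 1 ≤ N →
      ({q : ℕ × (Fin d → ℕ) |
        q.1 ≤ N ∧ (∀ i, q.2 i ≤ N) ∧
        ∀ e : Fin d → Bool,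
          IsSquare (q.1 + ∑ i, if e i then q.2 i else 0)}.ncard : ℝ) ≤
        C * (N : ℝ) ^ ((1 : ℝ) + ε) := by
  have hd0 : (0 : ℝ) < d := by exact_mod_cast (by omega : 0 < d)
  obtain ⟨C, hC, hdiv⟩ := exists_card_divisors_le_mul_rpow (ε / d) (by positivity)
  refine ⟨2 + 6 * (C + 1) ^ d, fun N hN => ?_⟩
  have hN1 : (1 : ℝ) ≤ N := by exact_mod_cast hN
  have hτ (n : ℕ) (hn : n ≠ 0) (hnN : n ≤ N) :
      (n.divisors.card : ℝ) + 1 ≤ (C + 1) * (N : ℝ) ^ (ε / d) := by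
    have h1 : (1 : ℝ) ≤ (N : ℝ) ^ (ε / d) := Real.one_le_rpow hN1 (by positivity)
    have h2 : (n.divisors.card : ℝ) ≤ C * (N : ℝ) ^ (ε / d) :=
      (hdiv n hn).trans (by gcongr)
    linarith
  have hpow : ((N : ℝ) ^ (ε / d)) ^ d = (N : ℝ) ^ ε := by
    rw [← Real.rpow_natCast, ← Real.rpow_mul (by positivity), div_mul_cancel₀ _ hd0.ne']
  have hNε : (1 : ℝ) ≤ (N : ℝ) ^ ε := Real.one_le_rpow hN1 hε.le
  calc _ ≤ ((squareCubeCover d N).card : ℝ) := by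
        rw [← Set.ncard_coe_finset]
        refine Nat.cast_le.mpr (Set.ncard_le_ncard ?_ (Finset.finite_toSet _))
        rintro q ⟨h0, hN, hq⟩
        exact mem_squareCubeCover h0 hN hq
    _ ≤ 2 * N + 6 * N * ((C + 1) * (N : ℝ) ^ (ε / d)) ^ d := card_squareCubeCover_le hN hτ
    _ = 2 * N * 1 + 6 * (C + 1) ^ d * (N * (N : ℝ) ^ ε) := by rw [mul_pow, hpow]; ring
    _ ≤ 2 * N * (N : ℝ) ^ ε + 6 * (C + 1) ^ d * (N * (N : ℝ) ^ ε) := by gcongr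
    _ = _ := by rw [Real.rpow_add (by positivity), Real.rpow_one]; ring
end

section
/- Let ℋ₊ denote the set of quadruples (a₀, a₁, a₂, a₃) of positive integers such that all eight sums a₀ + ε₁a₁ + ε₂a₂ + ε₃a₃ (εᵢ ∈ {0,1}) are perfect squares. Then for each pair of indices 0 ≤ i < j ≤ 3, the set of rationals H_{i,j} = {aᵢ/aⱼ : (a₀, a₁, a₂, a₃) ∈ ℋ₊} is dense in the set of positive real numbers for the Euclidean topology; that is, for every real x > 0 and every ε > 0 there exists (a₀, a₁, a₂, a₃) ∈ ℋ₊ with |aᵢ/aⱼ − x| < ε. -/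
/-- If a quotient `f / g` of continuous functions runs from `0` to `∞` on `(b, c)`, its values at
rational points of `(b, c)` are dense in the positive reals. -/
theorem exists_rat_abs_div_sub_lt {f g : ℝ → ℝ} (hf : Continuous f) (hg : Continuous g)
    {b c : ℝ} (hbc : b < c) (hfb : f b = 0) (hgb : 0 < g b) (hfc : 0 < f c) (hgc : g c = 0)
    (hpos : ∀ t, b < t → t < c → 0 < g t) {x ε : ℝ} (hx : 0 < x) (hε : 0 < ε) :
    ∃ t : ℚ, b < t ∧ (t : ℝ) < c ∧ |f t / g t - x| < ε := by
  have hcont : Continuous fun t => f t - x * g t := hf.sub (continuous_const.mul hg)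
  obtain ⟨u, ⟨hbu, huc⟩, hu⟩ : (0 : ℝ) ∈ (fun t => f t - x * g t) '' Set.Ioo b c := by
    refine intermediate_value_Ioo hbc.le hcont.continuousOn ⟨?_, ?_⟩
    · simpa [hfb] using mul_pos hx hgb
    · simpa [hgc] using hfc
  have hgu := hpos u hbu huc
  have hux : f u / g u = x := by
    rw [div_eq_iff hgu.ne']
    exact sub_eq_zero.mp hu
  have hquot : ContinuousAt (fun t => |f t / g t - x|) u :=
    ((hf.continuousAt.div hg.continuousAt hgu.ne').sub continuousAt_const).abs
  have hnear : ∀ᶠ t in nhds u, |f t / g t - x| < ε :=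
    hquot.eventually_lt continuousAt_const (by simpa [hux] using hε)
  have hIoo : ∀ᶠ t in nhds u, t ∈ Set.Ioo b c := Ioo_mem_nhds hbu huc
  obtain ⟨q, hq⟩ := Rat.denseRange_cast.exists_mem_open isOpen_interior
    ⟨u, mem_interior_iff_mem_nhds.mpr (hnear.and hIoo)⟩
  obtain ⟨hlt, hbq, hqc⟩ := interior_subset hq
  exact ⟨q, hbq, hqc, hlt⟩

/-- A cube of rational squares with positive coordinates can be scaled to a cube of integer
squares. -/
theorem exists_nat_cube_of_rat (e : Fin 4 → ℚ) (he : ∀ k, 0 < e k)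
    (hsq : ∀ ε₁ ε₂ ε₃ : Bool, IsSquare (e 0 + (if ε₁ then e 1 else 0) + (if ε₂ then e 2 else 0) +
      (if ε₃ then e 3 else 0))) :
    ∃ a : Fin 4 → ℕ, (∀ k, 0 < a k) ∧
      (∀ ε₁ ε₂ ε₃ : Bool,
        IsSquare (a 0 + (if ε₁ then a 1 else 0) + (if ε₂ then a 2 else 0) +
          (if ε₃ then a 3 else 0))) ∧
      ∀ i j, (a i : ℚ) / a j = e i / e j := by
  obtain ⟨N, hN, hmul⟩ : ∃ N : ℕ, 0 < N ∧ ∀ k, ∃ n : ℕ, (n : ℚ) = e k * N := by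
    refine ⟨∏ k, (e k).den, Finset.prod_pos fun k _ => (e k).den_pos, fun k => ?_⟩
    obtain ⟨c, hc⟩ := Finset.dvd_prod_of_mem (fun k => (e k).den) (Finset.mem_univ k)
    refine ⟨(e k).num.toNat * c, ?_⟩
    have hnum : (((e k).num.toNat : ℕ) : ℚ) = (e k).num := by
      exact_mod_cast Int.toNat_of_nonneg (Rat.num_pos.mpr (he k)).le
    rw [hc]
    push_cast
    rw [hnum, ← mul_assoc, Rat.mul_den_eq_num]
  choose n hn using hmul
  have hNpos : (0 : ℚ) < N := by exact_mod_cast hN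
  have hcast : ∀ k, ((n k * N : ℕ) : ℚ) = e k * (N * N) := fun k => by
    rw [Nat.cast_mul, hn, mul_assoc]
  refine ⟨fun k => n k * N, fun k => ?_, fun ε₁ ε₂ ε₃ => ?_, fun i j => ?_⟩
  · have : (0 : ℚ) < ((n k * N : ℕ) : ℚ) := by
      rw [hcast]
      exact mul_pos (he k) (mul_pos hNpos hNpos)
    exact_mod_cast this
  · rw [← Rat.isSquare_natCast_iff]
    have key := (hsq ε₁ ε₂ ε₃).mul (IsSquare.mul_self (N : ℚ))
    simp only [add_mul, ite_mul, zero_mul, ← hcast] at key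
    exact_mod_cast key
  · simp only [hcast]
    exact mul_div_mul_right _ _ (mul_pos hNpos hNpos).ne'

section Family

variable {K : Type*} [Field K]

def sumPart (t : K) : K := (5 * t ^ 2 - 1) * (7 * t ^ 4 + 50 * t ^ 2 + 7)

def diffPart (t : K) : K := (7 * t ^ 2 + 1) ^ 2 * t * (5 - t ^ 2)

/-- Base point of a one-parameter family of cubes of squares with edges `edge t`, `edge t`
and `lastEdge t`. -/
def base (t : K) : K := (sumPart t - diffPart t) ^ 2

def edge (t : K) : K :=
  24 * (t ^ 4 - 1) * (t ^ 2 - 1) * (7 * t ^ 2 + 1) ^ 2 * (34 * t ^ 2 - t ^ 4 - 1)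

def lastEdge (t : K) : K := 4 * sumPart t * diffPart t

theorem isSquare_base (t : K) : IsSquare (base t) := ⟨sumPart t - diffPart t, by
  unfold base; ring⟩

theorem isSquare_base_add_lastEdge (t : K) : IsSquare (base t + lastEdge t) :=
  ⟨sumPart t + diffPart t, by unfold base lastEdge; ring⟩

theorem isSquare_base_add_edge (t : K) : IsSquare (base t + edge t) :=
  ⟨sumPart t * t - (7 * t ^ 2 + 1) ^ 2 * (5 - t ^ 2), by
    unfold base edge sumPart diffPart; ring⟩

theorem isSquare_base_add_edge_add_lastEdge (t : K) :
    IsSquare (base t + edge t + lastEdge t) :=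
  ⟨sumPart t * t + (7 * t ^ 2 + 1) ^ 2 * (5 - t ^ 2), by
    unfold base edge lastEdge sumPart diffPart; ring⟩

theorem isSquare_base_add_edge_add_edge (t : K) : IsSquare (base t + edge t + edge t) :=
  ⟨(7 * t ^ 4 + 50 * t ^ 2 + 7) * t * (5 - t ^ 2) - (7 * t ^ 2 + 1) ^ 2 * (5 * t ^ 2 - 1), by
    unfold base edge sumPart diffPart; ring⟩

theorem isSquare_base_add_edge_add_edge_add_lastEdge (t : K) :
    IsSquare (base t + edge t + edge t + lastEdge t) :=
  ⟨(7 * t ^ 4 + 50 * t ^ 2 + 7) * t * (5 - t ^ 2) + (7 * t ^ 2 + 1) ^ 2 * (5 * t ^ 2 - 1), by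
    unfold base edge lastEdge sumPart diffPart; ring⟩

variable [LinearOrder K] [IsStrictOrderedRing K]

theorem lastEdge_pos {t : K} (h1 : 1 < t) (h5 : t ^ 2 < 5) : 0 < lastEdge t := by
  have h : 0 < 5 * t ^ 2 - 1 := by nlinarith
  have hd : 0 < 5 - t ^ 2 := sub_pos.mpr h5
  have ht : 0 < t := one_pos.trans h1
  unfold lastEdge sumPart diffPart
  positivity

theorem edge_pos {t : K} (h1 : 1 < t) (h5 : t ^ 2 ≤ 5) : 0 < edge t := by
  have h : 0 < t ^ 2 - 1 := by nlinarith
  have hd : 0 < t ^ 4 - 1 := by nlinarith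
  have h34 : 0 < 34 * t ^ 2 - t ^ 4 - 1 := by nlinarith
  unfold edge
  positivity

theorem base_pos {t : K} (h1 : 1 < t) : 0 < base t := by
  obtain ⟨u, hu, rfl⟩ : ∃ u : K, 0 < u ∧ t = 1 + u := ⟨t - 1, sub_pos.mpr h1, by ring⟩
  have h : 0 < sumPart (1 + u) - diffPart (1 + u) := by
    unfold sumPart diffPart
    ring_nf
    positivity
  exact pow_pos h 2

end Family

theorem isSquare_cube_update (j : Fin 4) (hj : j ≠ 0) (t : ℚ) (ε₁ ε₂ ε₃ : Bool)
    (e : Fin 4 → ℚ) (h0 : e 0 = base t) (hlast : e j = lastEdge t)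
    (hedge : ∀ k, k ≠ 0 → k ≠ j → e k = edge t) :
    IsSquare (e 0 + (if ε₁ then e 1 else 0) + (if ε₂ then e 2 else 0) +
      (if ε₃ then e 3 else 0)) := by
  have s1 := isSquare_base t
  have s2 := isSquare_base_add_lastEdge t
  have s3 := isSquare_base_add_edge t
  have s4 := isSquare_base_add_edge_add_lastEdge t
  have s5 := isSquare_base_add_edge_add_edge t
  have s6 := isSquare_base_add_edge_add_edge_add_lastEdge t
  have h1 := hedge 1
  have h2 := hedge 2
  have h3 := hedge 3
  fin_cases j <;> simp at hj hlast h1 h2 h3 <;>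
    cases ε₁ <;> cases ε₂ <;> cases ε₃ <;>
    simp only [h0, hlast, h1, h2, h3, if_true, if_false, add_zero, Bool.false_eq_true,
      add_right_comm _ (lastEdge t) (edge t)] <;>
    assumption

theorem stmt10 (i j : Fin 4) (hij : i < j) (x : ℝ) (hx : 0 < x) (ε : ℝ) (hε : 0 < ε) :
    ∃ a : Fin 4 → ℕ, (∀ k, 0 < a k) ∧
      (∀ ε₁ ε₂ ε₃ : Bool,
        IsSquare (a 0 + (if ε₁ then a 1 else 0) + (if ε₂ then a 2 else 0) +
          (if ε₃ then a 3 else 0))) ∧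
      |((a i : ℝ) / (a j : ℝ)) - x| < ε := by
  have hj : j ≠ 0 := ((Fin.zero_le i).trans_lt hij).ne'
  have hsqrt : √(5 : ℝ) ^ 2 = 5 := Real.sq_sqrt (by norm_num)
  have hone : 1 < √(5 : ℝ) := by
    rw [Real.lt_sqrt zero_le_one]
    norm_num
  have hsq_lt : ∀ t : ℝ, 1 < t → t < √5 → t ^ 2 < 5 := fun t h1 h5 =>
    (Real.lt_sqrt (one_pos.trans h1).le).mp h5
  let e (K : Type) [Field K] (t : K) (k : Fin 4) : K :=
    if k = 0 then base t else if k = j then lastEdge t else edge t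
  have hej : ∀ t : ℝ, e ℝ t j = lastEdge t := fun t => by simp [e, hj]
  have hei : ∀ t : ℝ, e ℝ t i = if i = 0 then base t else edge t := fun t => by
    simp [e, hij.ne]
  have hcont : ∀ k, Continuous fun t => e ℝ t k := fun k => by
    simp only [e]
    split_ifs <;> simp only [base, edge, lastEdge, sumPart, diffPart] <;> fun_prop
  obtain ⟨t, h1, h5, hlt⟩ := exists_rat_abs_div_sub_lt (f := fun t => e ℝ t i)
    (g := fun t => e ℝ t j) (hcont i) (hcont j) hone
    (by
      simp only [hei]
      split_ifs <;> norm_num [base, edge, sumPart, diffPart])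
    (by
      simp only [hej]
      norm_num [lastEdge, sumPart, diffPart])
    (by
      simp only [hei]
      split_ifs
      · exact base_pos hone
      · exact edge_pos hone hsqrt.le)
    (by simp [hej, lastEdge, diffPart, hsqrt])
    (fun t h1 h5 => by
      simp only [hej]
      exact lastEdge_pos h1 (hsq_lt t h1 h5)) hx hε
  have hq5 : t ^ 2 < 5 := by exact_mod_cast hsq_lt t h1 h5
  have hq1 : 1 < t := by exact_mod_cast h1
  obtain ⟨a, ha, hsq, hratio⟩ := exists_nat_cube_of_rat (e ℚ t)
    (fun k => by
      simp only [e]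
      split_ifs
      exacts [base_pos hq1, lastEdge_pos hq1 hq5, edge_pos hq1 hq5.le])
    (fun ε₁ ε₂ ε₃ => isSquare_cube_update j hj t ε₁ ε₂ ε₃ _ (by simp [e]) (by simp [e, hj])
      fun k hk hkj => by simp [e, hk, hkj])
  refine ⟨a, ha, hsq, ?_⟩
  have hcast : ∀ k, ((e ℚ t k : ℚ) : ℝ) = e ℝ t k := fun k => by
    simp only [e]
    split_ifs <;> simp [base, edge, lastEdge, sumPart, diffPart]
  have h : (a i : ℝ) / a j = e ℝ t i / e ℝ t j := by
    rw [← hcast, ← hcast, ← Rat.cast_div, ← hratio i j, Rat.cast_div, Rat.cast_natCast,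
      Rat.cast_natCast]
  rwa [h]
end

section
/- For every integer t ≥ 7, define a₀ = 25(18t⁴ − 319t³ − 684t² + 319t + 18)², a₁ = 9(t−1)t(t+1)(9t−20)(11t+29)(20t+9)(29t−11), a₂ = 16(t+5)(t+6)(2t−3)(3t+2)(5t−7)(5t−1)(6t−1)(7t+5), a₃ = 7200(t²+1)²(9t²−40t−9)(10t²+9t−10). Then 0 < a₁ < a₂ < a₃ and all eight sums a₀ + ε₁a₁ + ε₂a₂ + ε₃a₃ (εᵢ ∈ {0,1}) are perfect squares of integers; that is, H(a₀; a₁, a₂, a₃) is a Hilbert cube of dimension 3 contained in the set of squares. -/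
theorem stmt12 (t : ℤ) (ht : 7 ≤ t) :
    let a₀ : ℤ := 25 * (18 * t ^ 4 - 319 * t ^ 3 - 684 * t ^ 2 + 319 * t + 18) ^ 2
    let a₁ : ℤ := 9 * (t - 1) * t * (t + 1) * (9 * t - 20) * (11 * t + 29) *
      (20 * t + 9) * (29 * t - 11)
    let a₂ : ℤ := 16 * (t + 5) * (t + 6) * (2 * t - 3) * (3 * t + 2) * (5 * t - 7) *
      (5 * t - 1) * (6 * t - 1) * (7 * t + 5)
    let a₃ : ℤ := 7200 * (t ^ 2 + 1) ^ 2 * (9 * t ^ 2 - 40 * t - 9) *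
      (10 * t ^ 2 + 9 * t - 10)
    0 < a₁ ∧ a₁ < a₂ ∧ a₂ < a₃ ∧
      ∀ ε₁ ε₂ ε₃ : Bool,
        IsSquare (a₀ + (if ε₁ then a₁ else 0) + (if ε₂ then a₂ else 0) +
          (if ε₃ then a₃ else 0)) := by
  intro a₀ a₁ a₂ a₃
  obtain ⟨s, hs, hts⟩ : ∃ s : ℤ, 0 ≤ s ∧ t = s + 7 := ⟨t - 7, by lia, by ring⟩
  refine ⟨?_, ?_, ?_, ?_⟩
  · have h : a₁ =
        516780 * s ^ 7 + 25572771 * s ^ 6 + 538672302 * s ^ 5 + 6260986683 * s ^ 4 +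
        43363418364 * s ^ 3 + 178940550348 * s ^ 2 + 407276253792 * s + 394315278336 := by
      simp only [a₁, hts]
      ring
    rw [h]
    positivity
  · have h : a₂ - a₁ =
        100800 * s ^ 8 + 6046740 * s ^ 7 + 158590733 * s ^ 6 + 2372068146 * s ^ 5 +
        22108069109 * s ^ 4 + 131382143172 * s ^ 3 + 485927983604 * s ^ 2 +
        1022370419616 * s + 936689660928 := by
      simp only [a₂, a₁, hts]
      ring
    have : 0 < a₂ - a₁ := by
      rw [h]
      positivity
    linarith
  · have h : a₃ - a₂ =
        547200 * s ^ 8 + 27427680 * s ^ 7 + 589757296 * s ^ 6 + 7061475552 * s ^ 5 +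
        50975232208 * s ^ 4 + 223049571264 * s ^ 3 + 556017869248 * s ^ 2 +
        650544206592 * s + 154643060736 := by
      simp only [a₃, a₂, hts]
      ring
    have : 0 < a₃ - a₂ := by
      rw [h]
      positivity
    linarith
  · rintro (_ | _) (_ | _) (_ | _) <;>
      simp only [a₀, a₁, a₂, a₃, if_true, if_false, Bool.false_eq_true]
    · exact ⟨90 * t ^ 4 - 1595 * t ^ 3 - 3420 * t ^ 2 + 1595 * t + 90, by ring⟩
    · exact ⟨810 * t ^ 4 - 1595 * t ^ 3 - 1980 * t ^ 2 + 1595 * t + 810, by ring⟩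
    · exact ⟨330 * t ^ 4 + 957 * t ^ 3 + 2820 * t ^ 2 - 957 * t + 330, by ring⟩
    · exact ⟨870 * t ^ 4 - 957 * t ^ 3 - 420 * t ^ 2 + 957 * t + 870, by ring⟩
    · exact ⟨90 * t ^ 4 + 1276 * t ^ 3 + 3060 * t ^ 2 - 1276 * t + 90, by ring⟩
    · exact ⟨810 * t ^ 4 - 1276 * t ^ 3 - 1260 * t ^ 2 + 1276 * t + 810, by ring⟩
    · exact ⟨330 * t ^ 4 + 1740 * t ^ 3 + 1740 * t - 330, by ring⟩
    · exact ⟨870 * t ^ 4 - 660 * t ^ 3 - 660 * t - 870, by ring⟩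
end

section
/- For all integers c, d, define a₀ = (c−d)²(7c⁴ + 12c³d − 22c²d² + 12cd³ + 7d⁴)², a₁ = −24(c−d)²(c+d)²(c²+d²)(c²−6cd+d²)(c²+6cd+d²), a₃ = −4cd(c²−5d²)(5c²−d²)(7c²+d²)(c²+7d²). Then each of the six integers a₀, a₀ + a₁, a₀ + 2a₁, a₀ + a₃, a₀ + a₁ + a₃, a₀ + 2a₁ + a₃ is the square of an integer; that is, every element of the Hilbert cube H(a₀; a₁, a₁, a₃) is a square in ℤ. -/
theorem stmt13 (c d : ℤ) :
    let a₀ : ℤ := (c - d) ^ 2 * (7 * c ^ 4 + 12 * c ^ 3 * d - 22 * c ^ 2 * d ^ 2 +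
      12 * c * d ^ 3 + 7 * d ^ 4) ^ 2
    let a₁ : ℤ := -24 * (c - d) ^ 2 * (c + d) ^ 2 * (c ^ 2 + d ^ 2) *
      (c ^ 2 - 6 * c * d + d ^ 2) * (c ^ 2 + 6 * c * d + d ^ 2)
    let a₃ : ℤ := -4 * c * d * (c ^ 2 - 5 * d ^ 2) * (5 * c ^ 2 - d ^ 2) *
      (7 * c ^ 2 + d ^ 2) * (c ^ 2 + 7 * d ^ 2)
    IsSquare a₀ ∧ IsSquare (a₀ + a₁) ∧ IsSquare (a₀ + 2 * a₁) ∧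
      IsSquare (a₀ + a₃) ∧ IsSquare (a₀ + a₁ + a₃) ∧ IsSquare (a₀ + 2 * a₁ + a₃) := by
  intro a₀ a₁ a₃
  refine ⟨⟨7 * d ^ 5 + 5 * c * d ^ 4 - 34 * c ^ 2 * d ^ 3 + 34 * c ^ 3 * d ^ 2 - 5 * c ^ 4 * d - 7 * c ^ 5, ?_⟩,
    ⟨5 * d ^ 5 + 7 * c * d ^ 4 + 34 * c ^ 2 * d ^ 3 - 34 * c ^ 3 * d ^ 2 - 7 * c ^ 4 * d - 5 * c ^ 5, ?_⟩,
    ⟨d ^ 5 + 35 * c * d ^ 4 + 2 * c ^ 2 * d ^ 3 - 2 * c ^ 3 * d ^ 2 - 35 * c ^ 4 * d - c ^ 5, ?_⟩,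
    ⟨7 * d ^ 5 - 5 * c * d ^ 4 - 34 * c ^ 2 * d ^ 3 - 34 * c ^ 3 * d ^ 2 - 5 * c ^ 4 * d + 7 * c ^ 5, ?_⟩,
    ⟨5 * d ^ 5 - 7 * c * d ^ 4 + 34 * c ^ 2 * d ^ 3 + 34 * c ^ 3 * d ^ 2 - 7 * c ^ 4 * d + 5 * c ^ 5, ?_⟩,
    ⟨d ^ 5 - 35 * c * d ^ 4 + 2 * c ^ 2 * d ^ 3 + 2 * c ^ 3 * d ^ 2 - 35 * c ^ 4 * d + c ^ 5, ?_⟩⟩ <;>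
  · simp only [a₀, a₁, a₃]
    ring
end

section
/- For all integers u, v, define a₀ = (2u⁴ − 5u²v² − 4uv³ − 2v⁴)², a₁ = a₂ = 4u(u−v)v(u+v)(2u+v)(u+2v)(u² + uv + v²), a₃ = −u(u+2v)(u² − 2uv − 2v²)(u² + 2v²)(3u² + 4uv + 2v²), and A₃ = v(2u+v)(2u² + 2uv − v²)(2u² + v²)(2u² + 4uv + 3v²). Then all eight sums a₀ + ε₁a₁ + ε₂a₂ + ε₃a₃ (εᵢ ∈ {0,1}) are squares of integers, and all eight sums a₀ + ε₁a₁ + ε₂a₂ + ε₃A₃ (εᵢ ∈ {0,1}) are squares of integers; that is, H(a₀; a₁, a₂, a₃) and H(a₀; a₁, a₂, A₃) are two Hilbert cubes consisting of squares which share the same a₀, a₁, a₂. -/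
theorem stmt14 (u v : ℤ) :
    let a₀ : ℤ := (2 * u ^ 4 - 5 * u ^ 2 * v ^ 2 - 4 * u * v ^ 3 - 2 * v ^ 4) ^ 2
    let a₁ : ℤ := 4 * u * (u - v) * v * (u + v) * (2 * u + v) * (u + 2 * v) *
      (u ^ 2 + u * v + v ^ 2)
    let a₂ : ℤ := 4 * u * (u - v) * v * (u + v) * (2 * u + v) * (u + 2 * v) *
      (u ^ 2 + u * v + v ^ 2)
    let a₃ : ℤ := -u * (u + 2 * v) * (u ^ 2 - 2 * u * v - 2 * v ^ 2) *
      (u ^ 2 + 2 * v ^ 2) * (3 * u ^ 2 + 4 * u * v + 2 * v ^ 2)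
    let A₃ : ℤ := v * (2 * u + v) * (2 * u ^ 2 + 2 * u * v - v ^ 2) *
      (2 * u ^ 2 + v ^ 2) * (2 * u ^ 2 + 4 * u * v + 3 * v ^ 2)
    (∀ ε₁ ε₂ ε₃ : Bool,
      IsSquare (a₀ + (if ε₁ then a₁ else 0) + (if ε₂ then a₂ else 0) +
        (if ε₃ then a₃ else 0))) ∧
    (∀ ε₁ ε₂ ε₃ : Bool,
      IsSquare (a₀ + (if ε₁ then a₁ else 0) + (if ε₂ then a₂ else 0) +
        (if ε₃ then A₃ else 0))) := by
  intro a₀ a₁ a₂ a₃ A₃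
  constructor
  · rintro (_ | _) (_ | _) (_ | _) <;> simp only [a₀, a₁, a₂, a₃, Bool.false_eq_true, ↓reduceIte]
    · exact ⟨2 * u ^ 4 - 5 * u ^ 2 * v ^ 2 - 4 * u * v ^ 3 - 2 * v ^ 4, by ring⟩
    · exact ⟨u ^ 4 - 2 * u ^ 3 * v - 7 * u ^ 2 * v ^ 2 - 8 * u * v ^ 3 - 2 * v ^ 4, by ring⟩
    · exact ⟨2 * u ^ 4 + 2 * u ^ 3 * v + u ^ 2 * v ^ 2 + 2 * u * v ^ 3 + 2 * v ^ 4, by ring⟩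
    · exact ⟨u ^ 4 + 2 * u ^ 3 * v + 7 * u ^ 2 * v ^ 2 + 6 * u * v ^ 3 + 2 * v ^ 4, by ring⟩
    · exact ⟨2 * u ^ 4 + 2 * u ^ 3 * v + u ^ 2 * v ^ 2 + 2 * u * v ^ 3 + 2 * v ^ 4, by ring⟩
    · exact ⟨u ^ 4 + 2 * u ^ 3 * v + 7 * u ^ 2 * v ^ 2 + 6 * u * v ^ 3 + 2 * v ^ 4, by ring⟩
    · exact ⟨2 * u ^ 4 + 4 * u ^ 3 * v + 5 * u ^ 2 * v ^ 2 - 2 * v ^ 4, by ring⟩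
    · exact ⟨u ^ 4 + 6 * u ^ 3 * v + 5 * u ^ 2 * v ^ 2 + 4 * u * v ^ 3 + 2 * v ^ 4, by ring⟩
  · rintro (_ | _) (_ | _) (_ | _) <;> simp only [a₀, a₁, a₂, A₃, Bool.false_eq_true, ↓reduceIte]
    · exact ⟨2 * u ^ 4 - 5 * u ^ 2 * v ^ 2 - 4 * u * v ^ 3 - 2 * v ^ 4, by ring⟩
    · exact ⟨2 * u ^ 4 + 4 * u ^ 3 * v + 5 * u ^ 2 * v ^ 2 + 6 * u * v ^ 3 + v ^ 4, by ring⟩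
    · exact ⟨2 * u ^ 4 + 2 * u ^ 3 * v + u ^ 2 * v ^ 2 + 2 * u * v ^ 3 + 2 * v ^ 4, by ring⟩
    · exact ⟨2 * u ^ 4 + 6 * u ^ 3 * v + 7 * u ^ 2 * v ^ 2 + 2 * u * v ^ 3 + v ^ 4, by ring⟩
    · exact ⟨2 * u ^ 4 + 2 * u ^ 3 * v + u ^ 2 * v ^ 2 + 2 * u * v ^ 3 + 2 * v ^ 4, by ring⟩
    · exact ⟨2 * u ^ 4 + 6 * u ^ 3 * v + 7 * u ^ 2 * v ^ 2 + 2 * u * v ^ 3 + v ^ 4, by ring⟩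
    · exact ⟨2 * u ^ 4 + 4 * u ^ 3 * v + 5 * u ^ 2 * v ^ 2 - 2 * v ^ 4, by ring⟩
    · exact ⟨2 * u ^ 4 + 8 * u ^ 3 * v + 7 * u ^ 2 * v ^ 2 + 2 * u * v ^ 3 - v ^ 4, by ring⟩
end

section
/- For every nonnegative integer n, define a₀ = n(n+1)/2, a₁ = 66(2n+1)², and a₂ = a₃ = 105(2n+1)². Then every element of the Hilbert cube H(a₀; a₁, a₂, a₃), i.e. every sum a₀ + ε₁a₁ + ε₂a₂ + ε₃a₃ with εᵢ ∈ {0,1}, is a triangular number; explicitly, each of a₀ + εa₁ + k·105(2n+1)² for ε ∈ {0,1} and k ∈ {0,1,2} equals m(m+1)/2 for some nonnegative integer m. -/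
theorem half_add_eq_half {a b c : ℕ} (h : a + 2 * b = c) : a / 2 + b = c / 2 := by
  omega

theorem stmt16 (n : ℕ) :
    ∀ e k : ℕ, e ≤ 1 → k ≤ 2 →
      ∃ m : ℕ, n * (n + 1) / 2 + e * (66 * (2 * n + 1) ^ 2) +
        k * (105 * (2 * n + 1) ^ 2) = m * (m + 1) / 2 := by
  intro e k he hk
  simp only [add_assoc (n * (n + 1) / 2)]
  interval_cases e <;> interval_cases k
  · exact ⟨n, half_add_eq_half (by ring)⟩
  · exact ⟨29 * n + 14, half_add_eq_half (by ring)⟩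
  · exact ⟨41 * n + 20, half_add_eq_half (by ring)⟩
  · exact ⟨23 * n + 11, half_add_eq_half (by ring)⟩
  · exact ⟨37 * n + 18, half_add_eq_half (by ring)⟩
  · exact ⟨47 * n + 23, half_add_eq_half (by ring)⟩
end

section
/- For every rational number c, define a₀ = (c−1)⁴(7c⁴ + 12c³ − 22c² + 12c + 7)², a₁ = a₂ = −24(c−1)⁴(c+1)²(c²+1)(c² − 6c + 1)(c² + 6c + 1), a₃ = −4c(c−1)²(c² − 5)(c² + 7)(5c² − 1)(7c² + 1), a₄ = −(1/4)(c³ + c² + 19c − 5)(3c³ − c² + 9c + 5)(5c³ − 19c² − c − 1)(5c³ + 9c² − c + 3). Then thirteen of the sixteen sums a₀ + ε₁a₁ + ε₂a₂ + ε₃a₃ + ε₄a₄ (εᵢ ∈ {0,1}) are squares of rational numbers, namely all of them except possibly a₀ + a₄, a₀ + a₁ + a₂ + a₄, and a₀ + a₁ + a₂ + a₃ + a₄. -/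
theorem stmt18 (c : ℚ) :
    let a₀ : ℚ := (c - 1) ^ 4 * (7 * c ^ 4 + 12 * c ^ 3 - 22 * c ^ 2 + 12 * c + 7) ^ 2
    let a₁ : ℚ := -24 * (c - 1) ^ 4 * (c + 1) ^ 2 * (c ^ 2 + 1) * (c ^ 2 - 6 * c + 1) *
      (c ^ 2 + 6 * c + 1)
    let a₂ : ℚ := -24 * (c - 1) ^ 4 * (c + 1) ^ 2 * (c ^ 2 + 1) * (c ^ 2 - 6 * c + 1) *
      (c ^ 2 + 6 * c + 1)
    let a₃ : ℚ := -4 * c * (c - 1) ^ 2 * (c ^ 2 - 5) * (c ^ 2 + 7) * (5 * c ^ 2 - 1) *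
      (7 * c ^ 2 + 1)
    let a₄ : ℚ := -(1 / 4) * (c ^ 3 + c ^ 2 + 19 * c - 5) * (3 * c ^ 3 - c ^ 2 + 9 * c + 5) *
      (5 * c ^ 3 - 19 * c ^ 2 - c - 1) * (5 * c ^ 3 + 9 * c ^ 2 - c + 3)
    ∀ ε₁ ε₂ ε₃ ε₄ : Bool,
      (ε₁, ε₂, ε₃, ε₄) ≠ (false, false, false, true) →
      (ε₁, ε₂, ε₃, ε₄) ≠ (true, true, false, true) →
      (ε₁, ε₂, ε₃, ε₄) ≠ (true, true, true, true) →
      IsSquare (a₀ + (if ε₁ then a₁ else 0) + (if ε₂ then a₂ else 0) +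
        (if ε₃ then a₃ else 0) + (if ε₄ then a₄ else 0)) := by
  intro a₀ a₁ a₂ a₃ a₄ ε₁ ε₂ ε₃ ε₄ h₁ h₂ h₃
  rcases ε₁ <;> rcases ε₂ <;> rcases ε₃ <;> rcases ε₄ <;>
    simp only [Bool.false_eq_true, if_true, if_false, ne_eq, not_true_eq_false] at h₁ h₂ h₃ ⊢
  · exact ⟨7 * c ^ 6 - 2 * c ^ 5 - 39 * c ^ 4 + 68 * c ^ 3 - 39 * c ^ 2 - 2 * c + 7, by ring⟩
  · exact ⟨7 * c ^ 6 - 12 * c ^ 5 - 29 * c ^ 4 + 29 * c ^ 2 + 12 * c - 7, by ring⟩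
  · exact ⟨(11 * c ^ 6 - 26 * c ^ 5 - 123 * c ^ 4 + 20 * c ^ 3 - 123 * c ^ 2 - 26 * c + 11) / 2, by ring⟩
  · exact ⟨5 * c ^ 6 + 2 * c ^ 5 + 27 * c ^ 4 - 68 * c ^ 3 + 27 * c ^ 2 + 2 * c + 5, by ring⟩
  · exact ⟨(5 * c ^ 6 + 18 * c ^ 5 - 21 * c ^ 4 + 252 * c ^ 3 - 21 * c ^ 2 + 18 * c + 5) / 2, by ring⟩
  · exact ⟨5 * c ^ 6 - 12 * c ^ 5 + 41 * c ^ 4 - 41 * c ^ 2 + 12 * c - 5, by ring⟩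
  · exact ⟨(5 * c ^ 6 - 38 * c ^ 5 - 21 * c ^ 4 - 148 * c ^ 3 - 21 * c ^ 2 - 38 * c + 5) / 2, by ring⟩
  · exact ⟨5 * c ^ 6 + 2 * c ^ 5 + 27 * c ^ 4 - 68 * c ^ 3 + 27 * c ^ 2 + 2 * c + 5, by ring⟩
  · exact ⟨(5 * c ^ 6 + 18 * c ^ 5 - 21 * c ^ 4 + 252 * c ^ 3 - 21 * c ^ 2 + 18 * c + 5) / 2, by ring⟩
  · exact ⟨5 * c ^ 6 - 12 * c ^ 5 + 41 * c ^ 4 - 41 * c ^ 2 + 12 * c - 5, by ring⟩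
  · exact ⟨(5 * c ^ 6 - 38 * c ^ 5 - 21 * c ^ 4 - 148 * c ^ 3 - 21 * c ^ 2 - 38 * c + 5) / 2, by ring⟩
  · exact ⟨c ^ 6 + 34 * c ^ 5 - 33 * c ^ 4 - 4 * c ^ 3 - 33 * c ^ 2 + 34 * c + 1, by ring⟩
  · exact ⟨c ^ 6 - 36 * c ^ 5 + 37 * c ^ 4 - 37 * c ^ 2 + 36 * c - 1, by ring⟩
end
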